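/- For every δ ∈ (0,1) there is a constant c₃(δ) ≥ 2 depending only on d ≥ 3 and δ such that: for all integers L ≥ 1 and K ≥ c₃(δ), every nonempty A ⊆ B(0,L), every finite B ⊂ ℤ^d with B ∩ B(0,KL) = A and ℤ^d∖B connected, and every y ∈ A, one has e_B(A) := Σ_{z∈A} e_B(z) > 0 and (1 − δ/10)·ē_A(y) ≤ e_B(y)/e_B(A) ≤ (1 + δ/10)·ē_A(y). -/

import Mathlib

open MeasureTheory ENNReal Set
open scoped Classical NNReal

namespace Disconnection

/-- Points of `ℤ^d`. -/
abbrev Zd (d : ℕ) := Fin d → ℤ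

/-- Step distribution of the simple random walk: uniform weight `1/(2d)` on each of the
`2d` unit vectors of `ℤ^d`. -/
noncomputable def stepP (d : ℕ) (v : Zd d) : ℝ≥0∞ :=
  if (∑ i, (v i).natAbs) = 1 then ((2 * d : ℕ) : ℝ≥0∞)⁻¹ else 0

/-- The exponential distribution of rate `1` on `[0,∞)` (as a measure on `ℝ`). -/
noncomputable def expMeasure : Measure ℝ :=
  MeasureTheory.volume.withDensity fun t => ENNReal.ofReal (if 0 < t then Real.exp (-t) else 0)

/-- Nearest neighbours in `ℤ^d` (Euclidean distance one). -/
def adjacent {d : ℕ} (x y : Zd d) : Prop := (∑ i, (x i - y i).natAbs) = 1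

/-- (Outer) boundary `∂A` of a set `A ⊆ ℤ^d`. -/
def bdry {d : ℕ} (A : Set (Zd d)) : Set (Zd d) := {y | y ∉ A ∧ ∃ x ∈ A, adjacent x y}

/-- sup-norm distance between two points of `ℤ^d`. -/
def supDist {d : ℕ} (x y : Zd d) : ℕ := Finset.univ.sup fun i => (x i - y i).natAbs

/-- closed sup-norm ball `B(x,r)` in `ℤ^d`. -/
def ball {d : ℕ} (x : Zd d) (r : ℕ) : Set (Zd d) := {y | supDist x y ≤ r}

/-- mutual sup-norm distance between two sets. -/
noncomputable def setDist {d : ℕ} (A B : Set (Zd d)) : ℕ := sInf {n | ∃ x ∈ A, ∃ y ∈ B, supDist x y = n}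

/-- the box `ℤ^d ∩ [a,b)^d`. -/
def intBox {d : ℕ} (a b : ℤ) : Set (Zd d) := {y | ∀ i, a ≤ y i ∧ y i < b}

/-- A box in `ℤ^d`: a translate of `[0,L)^d ∩ ℤ^d` with `L ≥ 1`. -/
def isBox {d : ℕ} (S : Set (Zd d)) : Prop :=
  ∃ L : ℕ, 1 ≤ L ∧ ∃ a : Zd d, S = {y | ∀ i, a i ≤ y i ∧ y i < a i + L}

/-- connectedness of a subset of `ℤ^d` by nearest-neighbour paths. -/
def connSet {d : ℕ} (S : Set (Zd d)) : Prop :=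
  ∀ a ∈ S, ∀ b ∈ S, ∃ (n : ℕ) (f : ℕ → Zd d), f 0 = a ∧ f n = b ∧
    (∀ k ≤ n, f k ∈ S) ∧ ∀ k < n, adjacent (f k) (f (k + 1))

/-- Euclidean norm of a lattice point. -/
noncomputable def eucNorm {d : ℕ} (x : Zd d) : ℝ := Real.sqrt (∑ i, ((x i : ℝ)) ^ 2)

/-- A model of the continuous-time simple random walk on `ℤ^d` with unit jump rate:
`Y` is the discrete jump chain and `ζ` are the holding times; under `P x` one has
`Y 0 = x` a.s., and the increments of `Y` together with the holding times are mutually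
independent, the increments uniform on the `2d` unit vectors and the holding times
exponential of rate `1`.  This is expressed through the finite-dimensional cylinder
probabilities, which determine the joint law. -/
structure SRW (d : ℕ) (Ω : Type*) [MeasurableSpace Ω] where
  P : Zd d → Measure Ω
  isProb : ∀ x, IsProbabilityMeasure (P x)
  Y : ℕ → Ω → Zd d
  ζ : ℕ → Ω → ℝ
  measurable_Y : ∀ n, Measurable (Y n)
  measurable_ζ : ∀ n, Measurable (ζ n)
  Y_zero : ∀ x : Zd d, P x {ω | Y 0 ω = x} = 1
  law : ∀ (x : Zd d) (n : ℕ) (s : Fin n → Zd d) (I : Fin n → Set ℝ),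
    (∀ i, MeasurableSet (I i)) →
    P x {ω | (∀ i : Fin n, Y ((i : ℕ) + 1) ω - Y (i : ℕ) ω = s i) ∧
             (∀ i : Fin n, ζ (i : ℕ) ω ∈ I i)}
      = (∏ i, stepP d (s i)) * ∏ i, expMeasure (I i)

namespace SRW

variable {d : ℕ} {Ω : Type*} [MeasurableSpace Ω]

/-- time of the `n`-th jump. -/
noncomputable def S (W : SRW d Ω) (n : ℕ) (ω : Ω) : ℝ := ∑ i ∈ Finset.range n, W.ζ i ω

/-- index of the current step of the jump chain at time `t`. -/
noncomputable def jumpIdx (W : SRW d Ω) (t : ℝ) (ω : Ω) : ℕ := sSup {k : ℕ | W.S k ω ≤ t}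

/-- the continuous-time walk `X_t`. -/
noncomputable def X (W : SRW d Ω) (t : ℝ) (ω : Ω) : Zd d := W.Y (W.jumpIdx t ω) ω

/-- entrance time of `A` after time `t` (`∞` if there is none). -/
noncomputable def hitFrom (W : SRW d Ω) (A : Set (Zd d)) (t : ℝ≥0∞) (ω : Ω) : ℝ≥0∞ :=
  sInf {u : ℝ≥0∞ | ∃ s : ℝ≥0, u = (s : ℝ≥0∞) ∧ t ≤ u ∧ W.X (s : ℝ) ω ∈ A}

/-- entrance time `H_A = inf {t ≥ 0 : X_t ∈ A}`. -/
noncomputable def hit (W : SRW d Ω) (A : Set (Zd d)) (ω : Ω) : ℝ≥0∞ := W.hitFrom A 0 ω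

/-- exit time `T_U = inf {t ≥ 0 : X_t ∉ U}`. -/
noncomputable def exit (W : SRW d Ω) (U : Set (Zd d)) (ω : Ω) : ℝ≥0∞ := W.hit Uᶜ ω

/-- hitting time `H̃_A = inf {t ≥ ζ₀ : X_t ∈ A}`. -/
noncomputable def hitTilde (W : SRW d Ω) (A : Set (Zd d)) (ω : Ω) : ℝ≥0∞ :=
  W.hitFrom A (ENNReal.ofReal (W.ζ 0 ω)) ω

/-- the walk evaluated at a random (possibly infinite) time. -/
noncomputable def Xat (W : SRW d Ω) (τ : Ω → ℝ≥0∞) (ω : Ω) : Zd d := W.X (τ ω).toReal ω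

/-- equilibrium measure `e_A(x) = P_x[H̃_A = ∞] 1_A(x)`. -/
noncomputable def eqm (W : SRW d Ω) (A : Set (Zd d)) (x : Zd d) : ℝ :=
  if x ∈ A then (W.P x {ω | W.hitTilde A ω = ⊤}).toReal else 0

/-- capacity `cap(A) = Σ_x e_A(x)`. -/
noncomputable def cap (W : SRW d Ω) (A : Set (Zd d)) : ℝ := ∑ᶠ x, W.eqm A x

/-- normalized equilibrium measure `ē_A = e_A / cap(A)`. -/
noncomputable def ebar (W : SRW d Ω) (A : Set (Zd d)) (x : Zd d) : ℝ := W.eqm A x / W.cap A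

/-- equilibrium measure of `A` relative to `U`: `e_{A,U}(x) = P_x[H̃_A > T_U] 1_A(x)`. -/
noncomputable def eqmRel (W : SRW d Ω) (A U : Set (Zd d)) (x : Zd d) : ℝ :=
  if x ∈ A then (W.P x {ω | W.exit U ω < W.hitTilde A ω}).toReal else 0

/-- `P_ρ = Σ_x ρ(x) P_x`, the walk started from the initial (sub-)measure with density `ρ`. -/
noncomputable def Pinit (W : SRW d Ω) (ρ : Zd d → ℝ) : Measure Ω :=
  Measure.sum fun x : Zd d => ENNReal.ofReal (ρ x) • W.P x

/-- Green function `g(x,y) = E_x[∫₀^∞ 1{X_s = y} ds]`. -/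
noncomputable def green (W : SRW d Ω) (x y : Zd d) : ℝ :=
  ∫ ω, (∫ s in Set.Ioi (0 : ℝ), if W.X s ω = y then (1 : ℝ) else 0) ∂ W.P x

/-- killed Green function `g_U(x,y) = E_x[∫₀^{T_U} 1{X_s = y} ds]`. -/
noncomputable def greenK (W : SRW d Ω) (U : Set (Zd d)) (x y : Zd d) : ℝ :=
  ∫ ω, (∫ s in Set.Ioi (0 : ℝ),
      if ENNReal.ofReal s < W.exit U ω ∧ W.X s ω = y then (1 : ℝ) else 0) ∂ W.P x

/-- the potential operator `Gf(x) = Σ_y g(x,y) f(y)`. -/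
noncomputable def Gop (W : SRW d Ω) (f : Zd d → ℝ) (x : Zd d) : ℝ :=
  ∑ᶠ y, W.green x y * f y

/-- successive return times to `A` (between excursions out of `U`): `Rt A U 0 = R₁ = H_A`. -/
noncomputable def Rt (W : SRW d Ω) (A U : Set (Zd d)) : ℕ → Ω → ℝ≥0∞
  | 0 => W.hit A
  | k + 1 => fun ω => W.hitFrom A (W.hitFrom Uᶜ (W.Rt A U k ω) ω) ω

/-- successive departure times from `U`: `Dt A U k = D_{k+1}`. -/
noncomputable def Dt (W : SRW d Ω) (A U : Set (Zd d)) (k : ℕ) (ω : Ω) : ℝ≥0∞ :=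
  W.hitFrom Uᶜ (W.Rt A U k ω) ω

/-- number of excursions from `A` to the complement of `U`:
`N_{A,U} = sup {k ≥ 1 : D_k < ∞}` (with `sup ∅ = 0`). -/
noncomputable def Nexc (W : SRW d Ω) (A U : Set (Zd d)) (ω : Ω) : ℕ :=
  sSup {n | 0 < n ∧ W.Dt A U (n - 1) ω < ⊤}

end SRW

end Disconnection

open Disconnection

namespace S7

/-- unit vector -/
def ev {d : ℕ} (i : Fin d) : Zd d := Pi.single i 1

/-- averaging operator -/
noncomputable def Av {d : ℕ} (f : Zd d → ℝ) (x : Zd d) : ℝ :=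
  (∑ i : Fin d, (f (x + ev i) + f (x - ev i))) / (2 * d)

variable {d : ℕ}

lemma Av_add (f g : Zd d → ℝ) (x : Zd d) : Av (fun y => f y + g y) x = Av f x + Av g x := by
  unfold Av
  rw [← add_div, ← Finset.sum_add_distrib]
  congr 1
  exact Finset.sum_congr rfl fun i _ => by ring

lemma Av_mul (c : ℝ) (f : Zd d → ℝ) (x : Zd d) : Av (fun y => c * f y) x = c * Av f x := by
  unfold Av
  rw [← mul_div_assoc, Finset.mul_sum]
  congr 1
  exact Finset.sum_congr rfl fun i _ => by ring

lemma Av_sub (f g : Zd d → ℝ) (x : Zd d) : Av (fun y => f y - g y) x = Av f x - Av g x := by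
  unfold Av
  rw [← sub_div, ← Finset.sum_sub_distrib]
  congr 1
  exact Finset.sum_congr rfl fun i _ => by ring

lemma Av_const (hd : 3 ≤ d) (c : ℝ) (x : Zd d) : Av (fun _ => c) x = c := by
  unfold Av
  have : (0:ℝ) < d := by exact_mod_cast (by omega : 0 < d)
  simp
  field_simp
  ring

lemma Av_mono {f g : Zd d → ℝ} {x : Zd d}
    (h : ∀ i, f (x + ev i) ≤ g (x + ev i) ∧ f (x - ev i) ≤ g (x - ev i)) : Av f x ≤ Av g x := by
  unfold Av
  gcongr with i
  · exact (h i).1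
  · exact (h i).2

lemma Av_congr {f g : Zd d → ℝ} {x : Zd d}
    (h : ∀ i, f (x + ev i) = g (x + ev i) ∧ f (x - ev i) = g (x - ev i)) : Av f x = Av g x :=
  le_antisymm (Av_mono fun i => ⟨(h i).1.le, (h i).2.le⟩) (Av_mono fun i => ⟨(h i).1.ge, (h i).2.ge⟩)

lemma Av_ge {f : Zd d → ℝ} (hf : ∀ y, 0 ≤ f y) (x : Zd d) (i : Fin d) :
    f (x + ev i) / (2 * d) ≤ Av f x ∧ f (x - ev i) / (2 * d) ≤ Av f x := by
  have h := Finset.single_le_sum (f := fun i : Fin d => (f (x + ev i) + f (x - ev i)))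
    (fun i _ => add_nonneg (hf _) (hf _)) (Finset.mem_univ i)
  unfold Av
  constructor
  · gcongr; linarith [hf (x - ev i)]
  · gcongr; linarith [hf (x + ev i)]

/-- maximum principle -/
lemma maxP (hd : 3 ≤ d) (D : Finset (Zd d)) (E : Set (Zd d)) (f : Zd d → ℝ)
    (hN : ∀ x ∈ D, ∀ i, x + ev i ∈ E ∧ x - ev i ∈ E)
    (hE : ∀ y ∈ E, y ∉ D → f y ≤ 0)
    (hs : ∀ x ∈ D, f x ≤ Av f x) : ∀ x ∈ D, f x ≤ 0 := by
  by_contra! hc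
  obtain ⟨x0, hx0, hx0p⟩ := hc
  obtain ⟨x1, hx1, hmax⟩ := D.exists_max_image f ⟨x0, hx0⟩
  have hp : 0 < f x1 := lt_of_lt_of_le hx0p (hmax _ hx0)
  let i0 : Fin d := ⟨0, by omega⟩
  obtain ⟨x2, hx2, hmax2⟩ := (D.filter fun x => f x = f x1).exists_max_image (fun x => x i0)
    ⟨x1, by simp [hx1]⟩
  simp only [Finset.mem_filter] at hx2 hmax2
  have hle : ∀ y ∈ E, f y ≤ f x1 := fun y hy => by
    by_cases h : y ∈ D
    · exact hmax y h
    · exact (hE y hy h).trans hp.le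
  have h1 := hs x2 hx2.1
  have hnot : f (x2 + ev i0) < f x1 := by
    refine lt_of_le_of_ne (hle _ (hN _ hx2.1 i0).1) fun h => ?_
    have hD : x2 + ev i0 ∈ D := by
      by_contra hD
      have := hE _ (hN _ hx2.1 i0).1 hD
      linarith
    have := hmax2 _ ⟨hD, h⟩
    simp [ev] at this
  have h2 : Av f x2 < Av (fun _ => f x1) x2 := by
    unfold Av
    have : (0:ℝ) < d := by exact_mod_cast (by omega : 0 < d)
    refine div_lt_div_of_pos_right ?_ (by positivity)
    refine Finset.sum_lt_sum (fun i _ => add_le_add (hle _ (hN _ hx2.1 i).1) (hle _ (hN _ hx2.1 i).2))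
      ⟨i0, Finset.mem_univ _, add_lt_add_of_lt_of_le hnot (hle _ (hN _ hx2.1 i0).2)⟩
  rw [Av_const hd] at h2
  linarith [hx2.2]

lemma maxP' (hd : 3 ≤ d) (D : Finset (Zd d)) (f g : Zd d → ℝ)
    (hE : ∀ y, y ∉ D → f y ≤ g y)
    (hs : ∀ x ∈ D, f x ≤ Av f x) (hg : ∀ x ∈ D, Av g x ≤ g x) : ∀ x, f x ≤ g x := by
  intro x
  by_cases hx : x ∈ D
  · have := maxP hd D univ (fun y => f y - g y) (by simp) (fun y _ h => by linarith [hE y h])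
      (fun x hx => by rw [Av_sub]; linarith [hs x hx, hg x hx]) x hx
    linarith
  · exact hE x hx

/-- Dirichlet problem -/
lemma dirichlet (hd : 3 ≤ d) (D : Finset (Zd d)) (φ ψ : Zd d → ℝ) :
    ∃ g : Zd d → ℝ, (∀ x ∉ D, g x = φ x) ∧ ∀ x ∈ D, g x - Av g x = ψ x := by
  let ext : (D → ℝ) → Zd d → ℝ := fun u x => if h : x ∈ D then u ⟨x, h⟩ else 0
  have ext_add : ∀ u v, ext (u + v) = fun y => ext u y + ext v y := fun u v => by
    funext y; simp only [ext]; split_ifs <;> simp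
  have ext_smul : ∀ (c : ℝ) u, ext (c • u) = fun y => c * ext u y := fun c u => by
    funext y; simp only [ext]; split_ifs <;> simp
  let T : (D → ℝ) →ₗ[ℝ] (D → ℝ) :=
    { toFun := fun u x => u x - Av (ext u) x
      map_add' := fun u v => by
        funext x; simp only [ext_add, Av_add, Pi.add_apply]; ring
      map_smul' := fun c u => by
        funext x; simp only [ext_smul, Av_mul, Pi.smul_apply, smul_eq_mul, RingHom.id_apply]; ring }
  have inj : Function.Injective T := by
    rw [← LinearMap.ker_eq_bot, LinearMap.ker_eq_bot']
    intro u hu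
    have h : ∀ x (hx : x ∈ D), u ⟨x, hx⟩ = Av (ext u) x := fun x hx => by
      have := congrFun hu ⟨x, hx⟩
      simp only [T, LinearMap.coe_mk, AddHom.coe_mk, Pi.zero_apply] at this
      linarith
    have h' : ∀ x ∈ D, ext u x = Av (ext u) x := fun x hx => by
      rw [← h x hx]; simp [ext, hx]
    have a := maxP' hd D (ext u) (fun _ => 0) (fun y hy => by simp [ext, hy])
      (fun x hx => (h' x hx).le) (fun x hx => by rw [Av_const hd])
    have b := maxP' hd D (fun _ => 0) (ext u) (fun y hy => by simp [ext, hy])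
      (fun x hx => by rw [Av_const hd]) (fun x hx => (h' x hx).ge)
    funext x
    have := le_antisymm (a x) (b x)
    simpa [ext] using this
  have surj := LinearMap.injective_iff_surjective.1 inj
  let φ' : Zd d → ℝ := fun x => if x ∈ D then 0 else φ x
  obtain ⟨u, hu⟩ := surj fun x => ψ x + Av φ' x
  refine ⟨fun x => ext u x + φ' x, fun x hx => by simp [ext, φ', hx], fun x hx => ?_⟩
  have := congrFun hu ⟨x, hx⟩
  simp only [T, LinearMap.coe_mk, AddHom.coe_mk] at this
  rw [Av_add]
  simp only [ext, φ', hx, dite_true, if_true] at this ⊢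
  linarith

end S7

namespace S7
variable {d : ℕ}

lemma taylor2 (a : ℝ) : ∃ C > 0, ∃ η > 0, ∀ ε : ℝ, |ε| ≤ η →
    |(1 + ε) ^ a - (1 + a * ε + a * (a - 1) / 2 * ε ^ 2)| ≤ C * |ε| ^ 3 := by
  have h := (Real.one_add_rpow_hasFPowerSeriesAt_zero (a := a)).isBigO_sub_partialSum_pow 3
  rw [Asymptotics.isBigO_iff'] at h
  obtain ⟨C, hC, h⟩ := h
  rw [Metric.eventually_nhds_iff] at h
  obtain ⟨η, hη, h⟩ := h
  refine ⟨C, hC, η / 2, by positivity, fun ε hε => ?_⟩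
  have := h (y := ε) (by simp; linarith)
  simp [FormalMultilinearSeries.partialSum, Finset.sum_range_succ, binomialSeries] at this
  have hc : Ring.choose a 2 = a * (a - 1) / 2 := by
    have := Ring.descPochhammer_eq_factorial_smul_choose a 2
    simp [descPochhammer_succ_right, Nat.factorial] at this
    rw [Polynomial.smeval_mul, Polynomial.smeval_sub] at this
    simp at this
    linarith
  rw [hc] at this
  convert this using 3
  ring

/-- squared Euclidean norm -/
def q2 (x : Zd d) : ℝ := ∑ i, (x i : ℝ) ^ 2

lemma q2_nonneg (x : Zd d) : 0 ≤ q2 x := Finset.sum_nonneg fun _ _ => sq_nonneg _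

lemma q2_add (x : Zd d) (i : Fin d) : q2 (x + ev i) = q2 x + 1 + 2 * x i := by
  have : ∀ j, ((x + ev i) j : ℝ) ^ 2 = (x j : ℝ) ^ 2 + if j = i then 1 + 2 * (x i : ℝ) else 0 := by
    intro j
    by_cases h : j = i
    · subst h; simp [ev]; ring
    · simp [ev, h]
  simp only [q2, this, Finset.sum_add_distrib]
  simp; ring

lemma q2_sub (x : Zd d) (i : Fin d) : q2 (x - ev i) = q2 x + 1 - 2 * x i := by
  have : ∀ j, ((x - ev i) j : ℝ) ^ 2 = (x j : ℝ) ^ 2 + if j = i then 1 - 2 * (x i : ℝ) else 0 := by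
    intro j
    by_cases h : j = i
    · subst h; simp [ev]; ring
    · simp [ev, h]
  simp only [q2, this, Finset.sum_add_distrib]
  simp; ring

lemma sq_le_q2 (x : Zd d) (i : Fin d) : (x i : ℝ) ^ 2 ≤ q2 x :=
  Finset.single_le_sum (f := fun i => (x i : ℝ) ^ 2) (fun _ _ => sq_nonneg _) (Finset.mem_univ i)

lemma lap (hd : 3 ≤ d) (β : ℝ) : ∃ C > 0, ∃ s0 ≥ 1, ∀ x : Zd d, s0 ≤ q2 x →
    |Av (fun y => (q2 y) ^ (-β)) x - (q2 x) ^ (-β) * (1 + β * (4 * (β + 1) - 2 * d) / (2 * d) / q2 x)|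
      ≤ C * (q2 x) ^ (-β) * (q2 x) ^ (-(3 / 2) : ℝ) := by
  obtain ⟨C, hC, η, hη, hT⟩ := taylor2 (-β)
  have hd0 : (0:ℝ) < d := by exact_mod_cast (by omega : 0 < d)
  refine ⟨27 * C + |β * (β + 1) / 2|, by positivity, max 1 ((3 / η) ^ 2), le_max_left _ _, fun x hx => ?_⟩
  set s := q2 x with hs
  have hs1 : 1 ≤ s := (le_max_left _ _).trans hx
  have hs0 : 0 < s := by linarith
  have hr1 : 1 ≤ √s := by rwa [Real.one_le_sqrt]
  have hr2 : √s ^ 2 = s := Real.sq_sqrt hs0.le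
  have hr3 : 3 / η ≤ √s := Real.le_sqrt_of_sq_le ((le_max_right _ _).trans hx)
  have h32 : s ^ (-(3 / 2) : ℝ) = (√s ^ 3)⁻¹ := by
    rw [Real.rpow_neg hs0.le, Real.sqrt_eq_rpow, ← Real.rpow_natCast, ← Real.rpow_mul hs0.le]
    norm_num
  have hxi : ∀ i, |(x i : ℝ)| ≤ √s := fun i => Real.abs_le_sqrt (sq_le_q2 x i)
  have key : ∀ t : ℝ, |t| ≤ √s → |(s + 1 + 2 * t) ^ (-β) - s ^ (-β) * (1 - β * ((1 + 2 * t) / s)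
      + β * (β + 1) / 2 * ((1 + 2 * t) / s) ^ 2)| ≤ s ^ (-β) * (27 * C * (√s ^ 3)⁻¹) := by
    intro t ht
    have he : |(1 + 2 * t) / s| ≤ 3 / √s := by
      rw [abs_div, abs_of_pos hs0, div_le_div_iff₀ hs0 (by positivity)]
      have : |1 + 2 * t| ≤ 3 * √s := by
        calc |1 + 2 * t| ≤ |(1:ℝ)| + |2 * t| := abs_add_le _ _
          _ ≤ 3 * √s := by rw [abs_mul]; norm_num; linarith
      calc |1 + 2 * t| * √s ≤ 3 * √s * √s := by gcongr
        _ = 3 * s := by rw [mul_assoc, ← sq, hr2]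
    have he2 : |(1 + 2 * t) / s| ≤ η := by
      refine he.trans ?_
      rw [div_le_iff₀ hη] at hr3
      rw [div_le_iff₀ (by positivity)]; linarith
    have h1 := hT _ he2
    have h2 : s + 1 + 2 * t = s * (1 + (1 + 2 * t) / s) := by field_simp; ring
    have h3 : 0 ≤ 1 + (1 + 2 * t) / s := by
      have : 0 ≤ s + 1 + 2 * t := by
        have := (abs_le.1 ht).1
        nlinarith [sq_nonneg (√s - 1)]
      rw [h2] at this
      exact nonneg_of_mul_nonneg_right this hs0
    rw [h2, Real.mul_rpow hs0.le h3, ← mul_sub, abs_mul, abs_of_pos (Real.rpow_pos_of_pos hs0 _)]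
    gcongr
    calc _ = |(1 + (1 + 2 * t) / s) ^ (-β) - (1 + -β * ((1 + 2 * t) / s) +
        -β * (-β - 1) / 2 * ((1 + 2 * t) / s) ^ 2)| := by congr 1; ring
      _ ≤ C * |(1 + 2 * t) / s| ^ 3 := h1
      _ ≤ C * (3 / √s) ^ 3 := by gcongr
      _ = _ := by field_simp; norm_num
  have hB : s ^ (-β) * (1 + β * (4 * (β + 1) - 2 * d) / (2 * d) / s) + s ^ (-β) * (β * (β + 1) / 2 / s ^ 2) =
      (∑ i : Fin d, ((s ^ (-β) * (1 - β * ((1 + 2 * (x i : ℝ)) / s) + β * (β + 1) / 2 * ((1 + 2 * (x i : ℝ)) / s) ^ 2))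
       + (s ^ (-β) * (1 - β * ((1 + 2 * (-(x i : ℝ))) / s) + β * (β + 1) / 2 * ((1 + 2 * (-(x i : ℝ))) / s) ^ 2)))) / (2 * d) := by
    have : ∀ i : Fin d, ((s ^ (-β) * (1 - β * ((1 + 2 * (x i : ℝ)) / s) + β * (β + 1) / 2 * ((1 + 2 * (x i : ℝ)) / s) ^ 2))
       + (s ^ (-β) * (1 - β * ((1 + 2 * (-(x i : ℝ))) / s) + β * (β + 1) / 2 * ((1 + 2 * (-(x i : ℝ))) / s) ^ 2)))
       = s ^ (-β) * (2 - 2 * β / s + β * (β + 1) / s ^ 2) + s ^ (-β) * (4 * β * (β + 1) / s ^ 2) * (x i : ℝ) ^ 2 := by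
      intro i; field_simp; ring
    simp only [this, Finset.sum_add_distrib, ← Finset.mul_sum]
    rw [show ∑ i, (x i : ℝ) ^ 2 = s from rfl]
    simp
    field_simp
    ring
  have h1 : |Av (fun y => (q2 y) ^ (-β)) x - (s ^ (-β) * (1 + β * (4 * (β + 1) - 2 * d) / (2 * d) / s)
      + s ^ (-β) * (β * (β + 1) / 2 / s ^ 2))| ≤ s ^ (-β) * (27 * C * (√s ^ 3)⁻¹) := by
    rw [hB, Av, ← sub_div, ← Finset.sum_sub_distrib, abs_div, abs_of_pos (by positivity : (0:ℝ) < 2 * d),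
      div_le_iff₀ (by positivity)]
    refine (Finset.abs_sum_le_sum_abs _ _).trans ?_
    refine (Finset.sum_le_sum (g := fun _ => 2 * (s ^ (-β) * (27 * C * (√s ^ 3)⁻¹))) fun i _ => ?_).trans ?_
    · rw [q2_add, q2_sub, add_sub_add_comm, two_mul (s ^ (-β) * (27 * C * (√s ^ 3)⁻¹))]
      refine (abs_add_le _ _).trans (add_le_add ?_ ?_)
      · exact key _ (hxi i)
      · have := key (-(x i : ℝ)) (by rw [abs_neg]; exact hxi i)
        rwa [show s + 1 + 2 * (-(x i : ℝ)) = s + 1 - 2 * x i by ring] at this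
    · simp; apply le_of_eq; ring
  have h2 : |s ^ (-β) * (β * (β + 1) / 2 / s ^ 2)| ≤ s ^ (-β) * (|β * (β + 1) / 2| * (√s ^ 3)⁻¹) := by
    rw [abs_mul, abs_of_pos (Real.rpow_pos_of_pos hs0 _), abs_div (β * (β + 1) / 2), div_eq_mul_inv _ |s ^ 2|]
    have : √s ^ 3 ≤ |s ^ 2| := by
      rw [abs_of_pos (by positivity)]
      calc √s ^ 3 ≤ √s ^ 4 := pow_le_pow_right₀ hr1 (by norm_num)
        _ = (√s ^ 2) ^ 2 := by ring
        _ = s ^ 2 := by rw [hr2]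
    gcongr
  rw [h32]
  calc _ = |(Av (fun y => (q2 y) ^ (-β)) x - (s ^ (-β) * (1 + β * (4 * (β + 1) - 2 * d) / (2 * d) / s)
      + s ^ (-β) * (β * (β + 1) / 2 / s ^ 2))) + s ^ (-β) * (β * (β + 1) / 2 / s ^ 2)| := by congr 1; ring
    _ ≤ _ := (abs_add_le _ _).trans (add_le_add h1 h2)
    _ = _ := by ring

/-- Euclidean norm -/
noncomputable def nm (x : Zd d) : ℝ := √(q2 x)

lemma subsuper (hd : 3 ≤ d) : ∃ r0 : ℝ, 1 ≤ r0 ∧ ∃ fp fm : Zd d → ℝ, ∀ x, r0 ≤ nm x →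
    ((nm x) ^ (d - 2))⁻¹ / 2 ≤ fp x ∧ fp x ≤ ((nm x) ^ (d - 2))⁻¹ ∧
    ((nm x) ^ (d - 2))⁻¹ ≤ fm x ∧ fm x ≤ 2 * ((nm x) ^ (d - 2))⁻¹ ∧
    Av fp x ≤ fp x ∧ fm x ≤ Av fm x := by
  have hd0 : (0:ℝ) < d := by exact_mod_cast (by omega : 0 < d)
  have hd3 : (3:ℝ) ≤ d := by exact_mod_cast hd
  set β : ℝ := (d - 2) / 2 with hβ
  have hβ0 : 0 < β := by rw [hβ]; linarith
  set γ : ℝ := β + 1 / 4 with hγ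
  obtain ⟨C, hC, s0, hs0, h⟩ := lap hd β
  obtain ⟨C', hC', s0', hs0', h'⟩ := lap hd γ
  set κ := γ / (2 * d) with hκ
  have hκ0 : 0 < κ := by positivity
  set T := max (max s0 s0') (max 16 ((C + C') / κ) ^ 4) with hT
  have hTT : 1 ≤ T := hs0.le.trans ((le_max_left _ _).trans (le_max_left _ _))
  refine ⟨√T, by rwa [Real.one_le_sqrt], fun x => q2 x ^ (-β) - q2 x ^ (-γ), fun x => q2 x ^ (-β) + q2 x ^ (-γ), fun x hx => ?_⟩
  have hTs : T ≤ q2 x := (Real.sqrt_le_sqrt_iff (q2_nonneg x)).1 hx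
  set s := q2 x with hs
  have hsp : 0 < s := by linarith
  have h1 := h x ((le_max_left _ _).trans ((le_max_left _ _).trans hTs))
  have h2 := h' x ((le_max_right _ _).trans ((le_max_left _ _).trans hTs))
  have h3 := (le_max_right _ _).trans hTs
  rw [← hs] at h1 h2
  set t := s ^ (1 / 4 : ℝ) with ht
  have htp : 0 < t := Real.rpow_pos_of_pos hsp _
  have ht4 : t ^ 4 = s := by
    rw [ht, ← Real.rpow_natCast, ← Real.rpow_mul hsp.le]; norm_num
  have h3' : max 16 ((C + C') / κ) ≤ t := by
    rw [← ht4] at h3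
    exact le_of_pow_le_pow_left₀ (by norm_num) htp.le h3
  have ht16 : 16 ≤ t := (le_max_left _ _).trans h3'
  have htC : C + C' ≤ t * κ := by
    have := (le_max_right _ _).trans h3'
    rwa [div_le_iff₀ hκ0] at this
  set F := s ^ (-β) with hF
  have hFp : 0 < F := Real.rpow_pos_of_pos hsp _
  have hFn : ((nm x) ^ (d - 2))⁻¹ = F := by
    rw [hF, Real.rpow_neg hsp.le, nm, ← hs, Real.sqrt_eq_rpow, ← Real.rpow_natCast, ← Real.rpow_mul hsp.le,
      Nat.cast_sub (by omega)]
    congr 2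
    rw [hβ]; push_cast; ring
  have hG : s ^ (-γ) = F / t := by
    rw [hγ, neg_add, Real.rpow_add hsp, Real.rpow_neg hsp.le (1 / 4), div_eq_mul_inv F t]
  have h32 : s ^ (-(3 / 2) : ℝ) = (t ^ 6)⁻¹ := by
    rw [Real.rpow_neg hsp.le, ht, ← Real.rpow_natCast, ← Real.rpow_mul hsp.le]
    norm_num
  rw [show 4 * (β + 1) - 2 * d = (0:ℝ) by rw [hβ]; ring, h32] at h1
  rw [show 4 * (γ + 1) - 2 * d = (1:ℝ) by rw [hγ, hβ]; ring, h32, hG, mul_one, ← hκ, ← ht4] at h2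
  simp only [mul_zero, zero_div, add_zero, mul_one] at h1
  have hA : F / t * (κ / t ^ 4) - C' * (F / t) * (t ^ 6)⁻¹ ≤ Av (fun y => q2 y ^ (-γ)) x - F / t := by
    have := (abs_le.1 h2).1
    linarith
  have hB := abs_le.1 h1
  have hkey : C * F * (t ^ 6)⁻¹ ≤ F / t * (κ / t ^ 4) - C' * (F / t) * (t ^ 6)⁻¹ := by
    have e1 : F / t * (κ / t ^ 4) = F * (t ^ 6)⁻¹ * (t * κ) := by field_simp
    have e2 : C' * (F / t) * (t ^ 6)⁻¹ ≤ C' * F * (t ^ 6)⁻¹ := by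
      have : F / t ≤ F := div_le_self hFp.le (by linarith)
      gcongr
    have e3 : F * (t ^ 6)⁻¹ * (C + C') ≤ F * (t ^ 6)⁻¹ * (t * κ) := by gcongr
    rw [e1]; linarith
  have hFt : F / t ≤ F / 16 := by gcongr
  have hFt0 : 0 < F / t := by positivity
  rw [hFn, Av_sub, Av_add]
  simp only [← hs, ← hF, hG]
  refine ⟨?_, ?_, ?_, ?_, ?_, ?_⟩ <;> linarith [hB.1, hB.2]

end S7

namespace S7
variable {d : ℕ}

lemma nm_eq (x : Zd d) : nm x = ‖(WithLp.toLp 2 (fun i => (x i : ℝ)) : EuclideanSpace ℝ (Fin d))‖ := by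
  rw [EuclideanSpace.norm_eq]
  simp [nm, q2]

lemma nm_nonneg (x : Zd d) : 0 ≤ nm x := Real.sqrt_nonneg _

lemma nm_add (x y : Zd d) : nm (x + y) ≤ nm x + nm y := by
  simp only [nm_eq]
  refine le_trans (le_of_eq ?_) (norm_add_le _ _)
  congr 1
  ext i
  simp

lemma nm_neg (x : Zd d) : nm (-x) = nm x := by simp [nm, q2]

lemma nm_sub (x y : Zd d) : nm (x - y) ≤ nm x + nm y := by
  rw [sub_eq_add_neg, ← nm_neg y]; exact nm_add _ _

lemma nm_ev (i : Fin d) : nm (ev i) = 1 := by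
  have := q2_add (0 : Zd d) i
  simp [q2] at this
  simp [nm, q2, this]

lemma nm_zero : nm (0 : Zd d) = 0 := by simp [nm, q2]

lemma nm_step (x : Zd d) (i : Fin d) : nm (x + ev i) ≤ nm x + 1 ∧ nm x - 1 ≤ nm (x + ev i) ∧
    nm (x - ev i) ≤ nm x + 1 ∧ nm x - 1 ≤ nm (x - ev i) := by
  have h := nm_ev i
  refine ⟨?_, ?_, ?_, ?_⟩
  · linarith [nm_add x (ev i)]
  · have := nm_sub (x + ev i) (ev i)
    rw [add_sub_cancel_right] at this
    linarith
  · linarith [nm_sub x (ev i)]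
  · have := nm_add (x - ev i) (ev i)
    rw [sub_add_cancel] at this
    linarith

lemma abs_le_nm (x : Zd d) (i : Fin d) : |(x i : ℝ)| ≤ nm x := Real.abs_le_sqrt (sq_le_q2 x i)

lemma finite_nm (r : ℝ) : {x : Zd d | nm x < r}.Finite := by
  refine Set.Finite.subset (Set.finite_Icc (fun _ : Fin d => -⌈r⌉) (fun _ => ⌈r⌉)) fun x hx => ?_
  simp only [mem_ofPred_eq] at hx
  have h : ∀ i, |x i| ≤ ⌈r⌉ := fun i => by
    have h1 := abs_le_nm x i
    have h2 := Int.le_ceil r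
    have : ((|x i| : ℤ) : ℝ) ≤ (⌈r⌉ : ℝ) := by push_cast; linarith
    exact_mod_cast this
  exact ⟨fun i => (abs_le.1 (h i)).1, fun i => (abs_le.1 (h i)).2⟩

/-- Euclidean ball -/
noncomputable def Db (r : ℝ) : Finset (Zd d) := (finite_nm r).toFinset

lemma mem_Db {r : ℝ} {x : Zd d} : x ∈ Db r ↔ nm x < r := by simp [Db]

lemma inv_pow_le {a b : ℝ} (ha : 0 < a) (h : a ≤ b) (n : ℕ) : (b ^ n)⁻¹ ≤ (a ^ n)⁻¹ := by
  gcongr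

lemma escF (hd : 3 ≤ d) : ∃ r0 : ℝ, 1 ≤ r0 ∧ ∀ ρ, r0 ≤ ρ → ∃ F : Zd d → ℝ, (∀ x, 0 ≤ F x) ∧
    (∀ x, F x ≤ 1) ∧ (∀ x, nm x < ρ → F x = 1) ∧ (∀ x, ρ ≤ nm x → Av F x ≤ F x) ∧
    (∀ x, 4 * ρ ≤ nm x → F x ≤ 1 / 2) := by
  obtain ⟨t, ht, fp, fm, h⟩ := subsuper hd
  refine ⟨t + 1, by linarith, fun ρ hρ => ?_⟩
  have hρ0 : 0 < ρ := by linarith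
  set κ := (ρ ^ (d - 2))⁻¹ / 2 with hκ
  have hκ0 : 0 < κ := by positivity
  have hfp : ∀ x, t ≤ nm x → 0 ≤ fp x := fun x hx => by
    refine le_trans ?_ (h x hx).1
    have := nm_nonneg x
    positivity
  refine ⟨fun x => if nm x < ρ then 1 else min 1 (fp x / κ), fun x => ?_, fun x => ?_, fun x hx => by simp [hx],
    fun x hx => ?_, fun x hx => ?_⟩
  · dsimp only; split_ifs with hx
    · norm_num
    · exact le_min zero_le_one (div_nonneg (hfp x (by linarith)) hκ0.le)
  · dsimp only; split_ifs with hx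
    · norm_num
    · exact min_le_left _ _
  · simp only [not_lt.2 hx, if_false]
    refine le_min ?_ ?_
    · refine le_trans ?_ (Av_const hd 1 x).le
      have : ∀ y : Zd d, (if nm y < ρ then 1 else min 1 (fp y / κ)) ≤ 1 := fun y => by
        split_ifs
        · norm_num
        · exact min_le_left _ _
      exact Av_mono fun i => ⟨this _, this _⟩
    · have h1 : Av (fun y => κ⁻¹ * fp y) x ≤ fp x / κ := by
        rw [Av_mul, div_eq_inv_mul]
        exact mul_le_mul_of_nonneg_left (h x (by linarith)).2.2.2.2.1 (by positivity)
      refine le_trans ?_ h1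
      have : ∀ y : Zd d, nm x - 1 ≤ nm y → (if nm y < ρ then 1 else min 1 (fp y / κ)) ≤ κ⁻¹ * fp y := fun y hy => by
        rw [← div_eq_inv_mul]
        split_ifs with hy2
        · rw [le_div_iff₀ hκ0, one_mul]
          refine le_trans ?_ (h y (by linarith)).1
          rw [hκ]
          have := inv_pow_le (by linarith : 0 < nm y) hy2.le (d - 2)
          linarith
        · exact min_le_right _ _
      exact Av_mono fun i => ⟨this _ (nm_step x i).2.1, this _ (nm_step x i).2.2.2⟩
  · have : ¬ nm x < ρ := by linarith
    simp only [this, if_false]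
    refine (min_le_right _ _).trans ?_
    rw [div_le_iff₀ hκ0]
    refine (h x (by linarith)).2.1.trans ((inv_pow_le (by positivity) hx _).trans ?_)
    rw [hκ, mul_pow, mul_inv]
    have : ((4:ℝ) ^ (d - 2))⁻¹ ≤ 1 / 4 := by
      have := inv_pow_le (by norm_num : (0:ℝ) < 4) le_rfl 0
      calc ((4:ℝ) ^ (d - 2))⁻¹ ≤ (4 ^ 1)⁻¹ := by
            apply inv_anti₀ (by norm_num); exact pow_le_pow_right₀ (by norm_num) (by omega)
        _ = 1 / 4 := by norm_num
    have h2 : 0 ≤ (ρ ^ (d - 2))⁻¹ := by positivity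
    nlinarith

lemma chain (hd : 3 ≤ d) : ∀ (n : ℕ) (w : Zd d), ∑ i, (w i).natAbs = n → ∀ (x : Zd d) (g : Zd d → ℝ),
    (∀ y, 0 ≤ g y) → (∀ y, nm (y - x) ≤ n → Av g y ≤ g y) → g (x + w) ≤ (2 * d) ^ n * g x := by
  have hd0 : (0:ℝ) < d := by exact_mod_cast (by omega : 0 < d)
  intro n
  induction n with
  | zero =>
    intro w hw x g _ _
    have : w = 0 := by
      funext i
      simpa using (Finset.sum_eq_zero_iff.1 hw) i (Finset.mem_univ i)
    simp [this]
  | succ n ih =>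
    intro w hw x g hg hs
    obtain ⟨i, -, hi⟩ : ∃ i ∈ Finset.univ, (w i).natAbs ≠ 0 := by
      by_contra! hc
      rw [Finset.sum_eq_zero hc] at hw
      omega
    have hsum : ∀ w' : Zd d, (∀ j, j ≠ i → w' j = w j) → (w' i).natAbs + 1 = (w i).natAbs →
        ∑ i, (w' i).natAbs = n := by
      intro w' h1 h2
      rw [← Finset.add_sum_erase _ _ (Finset.mem_univ i)] at hw ⊢
      rw [Finset.sum_congr rfl (g := fun j => (w j).natAbs) (fun j hj => by rw [h1 j (Finset.ne_of_mem_erase hj)])]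
      omega
    have hx := hs x (by simp [nm_zero]; positivity)
    have hA := Av_ge hg x i
    rw [div_le_iff₀ (by positivity), div_le_iff₀ (by positivity)] at hA
    rcases lt_or_gt_of_ne (Int.natAbs_ne_zero.1 hi) with hneg | hpos
    · have := ih (w + ev i) (hsum _ (fun j hj => by simp [ev, hj]) (by simp [ev]; omega)) (x - ev i) g hg
        (fun y hy => hs y (by
          have := nm_sub (y - (x - ev i)) (ev i)
          rw [show y - (x - ev i) - ev i = y - x by abel, nm_ev] at this
          push_cast; linarith))
      rw [show x - ev i + (w + ev i) = x + w by abel] at this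
      calc _ ≤ _ := this
        _ ≤ (2 * d) ^ n * (g x * (2 * d)) := by
          gcongr; exact hA.2.trans (by gcongr)
        _ = _ := by ring
    · have := ih (w - ev i) (hsum _ (fun j hj => by simp [ev, hj]) (by simp [ev]; omega)) (x + ev i) g hg
        (fun y hy => hs y (by
          have := nm_add (y - (x + ev i)) (ev i)
          rw [show y - (x + ev i) + ev i = y - x by abel, nm_ev] at this
          push_cast; linarith))
      rw [show x + ev i + (w - ev i) = x + w by abel] at this
      calc _ ≤ _ := this
        _ ≤ (2 * d) ^ n * (g x * (2 * d)) := by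
          gcongr; exact hA.1.trans (by gcongr)
        _ = _ := by ring

lemma chain' (hd : 3 ≤ d) (t : ℕ) (x y : Zd d) (g : Zd d → ℝ) (hxy : nm (y - x) ≤ t)
    (hg : ∀ y, 0 ≤ g y) (hs : ∀ y, nm (y - x) ≤ (d * t : ℕ) → Av g y ≤ g y) :
    g y ≤ (2 * d) ^ (d * t) * g x := by
  have hn : ∑ i, ((y - x) i).natAbs ≤ d * t := by
    refine (Finset.sum_le_card_nsmul _ _ t fun i _ => ?_).trans (by simp)
    have := (abs_le_nm (y - x) i).trans hxy
    have h2 : ((((y - x) i).natAbs : ℕ) : ℝ) ≤ t := by rw [Nat.cast_natAbs]; push_cast at this ⊢; exact this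
    exact_mod_cast h2
  have := chain hd _ (y - x) rfl x g hg fun z hz => hs z (hz.trans (by exact_mod_cast hn))
  rw [add_sub_cancel] at this
  refine this.trans ?_
  gcongr
  · exact hg x
  · have : (3:ℝ) ≤ d := by exact_mod_cast hd
    linarith

/-- Green function ratio -/
lemma greenRatio (hd : 3 ≤ d) : ∃ r1 : ℝ, 1 ≤ r1 ∧ ∃ C : ℝ, 1 ≤ C ∧ ∀ r, r1 ≤ r → ∀ (z : Zd d) (g : Zd d → ℝ),
    3 * r ≤ nm z → nm z < 4 * r → (∀ y, 0 ≤ g y) → (∀ y, 24 * r ≤ nm y → g y = 0) →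
    (∀ y, nm y < 24 * r → Av g y ≤ g y) → (∀ y, nm y < 24 * r → y ≠ z → Av g y = g y) →
    ∀ x x', nm x < r → nm x' < r → g x ≤ C * g x' := by
  obtain ⟨t, ht, fp, fm, h⟩ := subsuper hd
  have hd3 : (3:ℝ) ≤ d := by exact_mod_cast hd
  set k := d - 2 with hk
  have hk1 : 1 ≤ k := by omega
  set T := ⌈t + 1⌉₊ with hT
  have hTt : t + 1 ≤ T := Nat.le_ceil _
  set C0 : ℝ := (2 * d) ^ (d * T) with hC0
  have hC01 : 1 ≤ C0 := one_le_pow₀ (by linarith)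
  have hC0p : 0 < C0 := by linarith
  refine ⟨t + 2 + (d * T : ℕ), by have : (0:ℝ) ≤ (d * T : ℕ) := Nat.cast_nonneg _
                                  linarith,
    8 * C0 ^ 2 * (5 * (t + 1)) ^ k, ?_, ?_⟩
  · have h1 : 1 ≤ C0 ^ 2 := one_le_pow₀ hC01
    have h2 : 1 ≤ (5 * (t + 1)) ^ k := one_le_pow₀ (by linarith)
    nlinarith
  intro r hr z g hz1 hz2 hg h0 hsup hharm x x' hx hx'
  have hN0 : (0:ℝ) ≤ (d * T : ℕ) := Nat.cast_nonneg _
  have hr0 : 0 < r := by linarith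
  have near : ∀ y, nm (y - z) < t + 1 → g y ≤ C0 * g z ∧ g z ≤ C0 * g y := by
    intro y hy
    have hzy : nm (z - y) < t + 1 := by rwa [← nm_neg, neg_sub]
    constructor
    · refine chain' hd T z y g (by linarith) hg fun w hw => hsup w ?_
      have := nm_add (w - z) z
      rw [sub_add_cancel] at this
      linarith
    · refine chain' hd T y z g (by linarith) hg fun w hw => hsup w ?_
      have h1 := nm_add (w - y) y
      have h2 := nm_add (y - z) z
      rw [sub_add_cancel] at h1 h2
      linarith
  set D' : Finset (Zd d) := (Db (24 * r)).filter fun y => t + 1 ≤ nm (y - z) with hD'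
  have memD : ∀ y, y ∈ D' ↔ nm y < 24 * r ∧ t + 1 ≤ nm (y - z) := fun y => by simp [hD', mem_Db]
  set E : Set (Zd d) := {y | t ≤ nm (y - z)} with hE
  have hN : ∀ y ∈ D', ∀ i, y + ev i ∈ E ∧ y - ev i ∈ E := by
    intro y hy i
    have := nm_step (y - z) i
    rw [show y - z + ev i = y + ev i - z by abel, show y - z - ev i = y - ev i - z by abel] at this
    have h2 := ((memD y).1 hy).2
    simp only [hE, mem_ofPred_eq]
    constructor <;> linarith
  have hyz : ∀ y, y ∈ D' → y ≠ z := by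
    rintro y hy rfl
    have := ((memD y).1 hy).2
    rw [sub_self, nm_zero] at this
    linarith
  have harm : ∀ y ∈ D', Av g y = g y := fun y hy => hharm y ((memD y).1 hy).1 (hyz y hy)
  have shift : ∀ (f : Zd d → ℝ) y, Av (fun w => f (w - z)) y = Av f (y - z) := by
    intro f y
    simp only [Av]
    congr 1
    refine Finset.sum_congr rfl fun i _ => ?_
    rw [show y - z + ev i = y + ev i - z by abel, show y - z - ev i = y - ev i - z by abel]
  have inD : ∀ w : Zd d, nm w < r → w ∈ D' ∧ 2 * r ≤ nm (w - z) ∧ nm (w - z) < 5 * r := by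
    intro w hw
    have h1 := nm_sub w (w - z)
    rw [_root_.sub_sub_cancel] at h1
    have h2 := nm_sub w z
    exact ⟨(memD w).2 ⟨by linarith, by linarith⟩, by linarith, by linarith⟩
  -- upper
  set cU := C0 * g z * (2 * (t + 1) ^ k) with hcU
  have hcU0 : 0 ≤ cU := by have := hg z; positivity
  have hU : g x - cU * fp (x - z) ≤ 0 := by
    refine maxP hd D' E (fun y => g y - cU * fp (y - z)) hN ?_ ?_ x (inD x hx).1
    · intro y hyE hyD
      have hf := (h (y - z) hyE).1
      have hpos : 0 < nm (y - z) := lt_of_lt_of_le (by linarith) hyE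
      by_cases hyR : nm y < 24 * r
      · have hyt : nm (y - z) < t + 1 := by
          by_contra hc
          exact hyD ((memD y).2 ⟨hyR, not_lt.1 hc⟩)
        have h1 := inv_pow_le hpos hyt.le k
        have : C0 * g z ≤ cU * fp (y - z) := by
          calc C0 * g z = cU * (((t + 1) ^ k)⁻¹ / 2) := by rw [hcU]; field_simp
            _ ≤ _ := by gcongr; linarith
        linarith [(near y hyt).1]
      · rw [h0 y (not_lt.1 hyR)]
        have : 0 ≤ fp (y - z) := le_trans (by positivity) hf
        have := mul_nonneg hcU0 this
        linarith
    · intro y hy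
      rw [Av_sub, harm y hy, Av_mul, shift]
      have := (h (y - z) (by linarith [((memD y).1 hy).2])).2.2.2.2.1
      have := mul_le_mul_of_nonneg_left this hcU0
      linarith
  -- lower
  set σ := 2 * ((20 * r) ^ k)⁻¹ with hσ
  set cL := g z / C0 * (t ^ k / 2) with hcL
  have hcL0 : 0 ≤ cL := by have := hg z; positivity
  have hL : cL * (fm (x' - z) - σ) - g x' ≤ 0 := by
    refine maxP hd D' E (fun y => cL * (fm (y - z) - σ) - g y) hN ?_ ?_ x' (inD x' hx').1
    · intro y hyE hyD
      have hf := (h (y - z) hyE).2.2.2.1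
      have hpos : 0 < nm (y - z) := lt_of_lt_of_le (by linarith) hyE
      by_cases hyR : nm y < 24 * r
      · have hyt : nm (y - z) < t + 1 := by
          by_contra hc
          exact hyD ((memD y).2 ⟨hyR, not_lt.1 hc⟩)
        have h1 := inv_pow_le (by linarith) hyE k
        have hσ0 : 0 ≤ σ := by positivity
        have : cL * (fm (y - z) - σ) ≤ g z / C0 := by
          calc _ ≤ cL * (2 * (t ^ k)⁻¹) := by gcongr; linarith
            _ = _ := by rw [hcL]; field_simp
        have h3 := (near y hyt).2
        have : g z / C0 ≤ g y := by rw [div_le_iff₀ hC0p]; linarith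
        linarith
      · have h1 := nm_add (y - z) z
        rw [sub_add_cancel] at h1
        have h2 := inv_pow_le (by linarith : 0 < 20 * r) (by linarith : 20 * r ≤ nm (y - z)) k
        have : cL * (fm (y - z) - σ) ≤ 0 := mul_nonpos_of_nonneg_of_nonpos hcL0 (by linarith)
        linarith [hg y]
    · intro y hy
      rw [Av_sub, harm y hy, Av_mul, Av_sub, shift, Av_const hd]
      have := (h (y - z) (by linarith [((memD y).1 hy).2])).2.2.2.2.2
      have := mul_le_mul_of_nonneg_left (sub_le_sub_right this σ) hcL0
      linarith
  set u := (r ^ k)⁻¹ with hu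
  have hu0 : 0 < u := by positivity
  have hx1 : fp (x - z) ≤ u := by
    refine (h (x - z) (by linarith [(inD x hx).2.1])).2.1.trans ?_
    exact inv_pow_le hr0 (by linarith [(inD x hx).2.1]) k
  have hx2 : (5 ^ k)⁻¹ * u / 2 ≤ fm (x' - z) - σ := by
    have h1 := (h (x' - z) (by linarith [(inD x' hx').2.1])).2.2.1
    have h2 := inv_pow_le (by linarith [(inD x' hx').2.1] : 0 < nm (x' - z)) (inD x' hx').2.2.le k
    have h3 : ((5 * r) ^ k)⁻¹ = (5 ^ k)⁻¹ * u := by rw [mul_pow, mul_inv]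
    have h4 : σ ≤ (5 ^ k)⁻¹ * u / 2 := by
      have : (((4:ℝ) ^ k)⁻¹) ≤ 1 / 4 := by
        calc ((4:ℝ) ^ k)⁻¹ ≤ (4 ^ 1)⁻¹ := by
              apply inv_anti₀ (by norm_num); exact pow_le_pow_right₀ (by norm_num) hk1
          _ = 1 / 4 := by norm_num
      rw [hσ, show 20 * r = 4 * (5 * r) by ring, mul_pow 4, mul_inv, h3]
      have : 0 < ((5:ℝ) ^ k)⁻¹ * u := by positivity
      nlinarith
    linarith
  have hg1 : g x ≤ cU * u := by
    have := mul_le_mul_of_nonneg_left hx1 hcU0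
    linarith
  have hg2 : cL * ((5 ^ k)⁻¹ * u / 2) ≤ g x' := by
    have := mul_le_mul_of_nonneg_left hx2 hcL0
    linarith
  have ht1 : 1 ≤ t ^ k := one_le_pow₀ ht
  calc g x ≤ cU * u := hg1
    _ = 8 * C0 ^ 2 * (5 * (t + 1)) ^ k * (g z / C0 * (1 / 2) * ((5 ^ k)⁻¹ * u / 2)) := by
      rw [hcU, mul_pow]; field_simp; norm_num
    _ ≤ 8 * C0 ^ 2 * (5 * (t + 1)) ^ k * (g z / C0 * (t ^ k / 2) * ((5 ^ k)⁻¹ * u / 2)) := by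
      have := hg z
      gcongr
    _ ≤ _ := by gcongr

end S7

namespace S7
variable {d : ℕ}

lemma Av_sum (S : Finset (Zd d)) (F : Zd d → Zd d → ℝ) (x : Zd d) :
    Av (fun y => ∑ z ∈ S, F z y) x = ∑ z ∈ S, Av (F z) x := by
  induction S using Finset.induction_on with
  | empty => simp [Av]
  | insert a S ha ih => simp only [Finset.sum_insert ha, Av_add, ih]

lemma harnack0 (hd : 3 ≤ d) : ∃ r1 : ℝ, 1 ≤ r1 ∧ ∃ C : ℝ, 1 ≤ C ∧ ∀ r, r1 ≤ r → ∀ (v : Zd d → ℝ),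
    (∀ y, 0 ≤ v y) → (∀ y, nm y < 24 * r → Av v y = v y) →
    ∀ x x', nm x < r → nm x' < r → v x ≤ C * v x' := by
  obtain ⟨r1, hr1, C, hC, H⟩ := greenRatio hd
  refine ⟨r1, hr1, C, hC, fun r hr v hv hharm x x' hx hx' => ?_⟩
  have hr0 : 1 ≤ r := by linarith
  obtain ⟨vh, hvh1, hvh2⟩ := dirichlet hd ((Db (24 * r)).filter fun y => 4 * r ≤ nm y)
    (fun y => if nm y < 4 * r then v y else 0) (fun _ => 0)
  simp only [Finset.mem_filter, mem_Db] at hvh1 hvh2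
  have vin : ∀ y, nm y < 4 * r → vh y = v y := fun y hy => by
    rw [hvh1 y (by intro h; linarith [h.2])]; simp [hy]
  have vout : ∀ y, 24 * r ≤ nm y → vh y = 0 := fun y hy => by
    rw [hvh1 y (by intro h; linarith [h.1])]
    have : ¬ nm y < 4 * r := by linarith
    simp [this]
  have vle : ∀ y, vh y ≤ v y := by
    refine maxP' hd ((Db (24 * r)).filter fun y => 4 * r ≤ nm y) vh v ?_ ?_ ?_
    · intro y hy
      simp only [Finset.mem_filter, mem_Db] at hy
      rw [hvh1 y hy]
      split_ifs
      · rfl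
      · exact hv y
    · intro y hy
      simp only [Finset.mem_filter, mem_Db] at hy
      linarith [hvh2 y hy]
    · intro y hy
      simp only [Finset.mem_filter, mem_Db] at hy
      exact (hharm y hy.1).le
  set μ : Zd d → ℝ := fun y => vh y - Av vh y with hμ
  have μ0 : ∀ y, nm y < 4 * r → 0 ≤ μ y := fun y hy => by
    have h1 : Av vh y ≤ Av v y := Av_mono fun i => ⟨vle _, vle _⟩
    rw [hharm y (by linarith)] at h1
    simp only [hμ]
    rw [vin y hy]
    linarith
  have μin : ∀ y, nm y < 3 * r → μ y = 0 := fun y hy => by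
    have h1 : Av vh y = Av v y := Av_congr fun i =>
      ⟨vin _ (by linarith [(nm_step y i).1]), vin _ (by linarith [(nm_step y i).2.2.1])⟩
    rw [hharm y (by linarith)] at h1
    simp only [hμ]
    rw [vin y (by linarith), h1, sub_self]
  have μmid : ∀ y, nm y < 24 * r → 4 * r ≤ nm y → μ y = 0 := fun y h1 h2 => hvh2 y ⟨h1, h2⟩
  choose g g1 g2 using fun z : Zd d => dirichlet hd (Db (24 * r)) (fun _ => 0) (fun y => if y = z then 1 else 0)
  simp only [mem_Db, not_lt] at g1 g2
  have gnn : ∀ z y, 0 ≤ g z y := fun z => by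
    refine maxP' hd (Db (24 * r)) (fun _ => 0) (g z) ?_ ?_ ?_
    · intro y hy; rw [g1 z y (by simpa [mem_Db] using hy)]
    · intro y hy; rw [Av_const hd]
    · intro y hy
      have := g2 z y (mem_Db.1 hy)
      split_ifs at this <;> linarith
  set S : Finset (Zd d) := (Db (4 * r)).filter fun z => 3 * r ≤ nm z with hS
  have repr : ∀ y, vh y = ∑ z ∈ S, μ z * g z y := by
    have A : ∀ y, nm y < 24 * r → Av (fun y => ∑ z ∈ S, μ z * g z y) y = (∑ z ∈ S, μ z * g z y) - μ y := by
      intro y hy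
      rw [Av_sum]
      have : ∀ z ∈ S, Av (fun y => μ z * g z y) y = μ z * g z y - if y = z then μ z else 0 := by
        intro z _
        rw [Av_mul, show Av (g z) y = g z y - if y = z then 1 else 0 by linarith [g2 z y hy]]
        split_ifs <;> ring
      rw [Finset.sum_congr rfl this, Finset.sum_sub_distrib, Finset.sum_ite_eq]
      congr 1
      split_ifs with h
      · rfl
      · symm
        simp only [hS, Finset.mem_filter, mem_Db, not_and, not_le] at h
        by_cases h4 : nm y < 4 * r
        · exact μin y (h h4)
        · exact μmid y hy (not_lt.1 h4)
    have Z : ∀ y, y ∉ Db (24 * r) → vh y = ∑ z ∈ S, μ z * g z y := by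
      intro y hy
      have hy' : 24 * r ≤ nm y := by simpa [mem_Db] using hy
      rw [vout y hy']
      exact (Finset.sum_eq_zero fun z _ => by rw [g1 z y hy', mul_zero]).symm
    intro y
    have e1 := maxP hd (Db (24 * r)) univ (fun y => vh y - ∑ z ∈ S, μ z * g z y) (by simp)
      (fun y _ hy => by linarith [Z y hy]) (fun y hy => by
        rw [Av_sub, A y (mem_Db.1 hy)]; simp only [hμ]; linarith)
    have e2 := maxP hd (Db (24 * r)) univ (fun y => (∑ z ∈ S, μ z * g z y) - vh y) (by simp)
      (fun y _ hy => by linarith [Z y hy]) (fun y hy => by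
        rw [Av_sub, A y (mem_Db.1 hy)]; simp only [hμ]; linarith)
    by_cases hy : y ∈ Db (24 * r)
    · linarith [e1 y hy, e2 y hy]
    · exact Z y hy
  rw [← vin x (by linarith), ← vin x' (by linarith), repr x, repr x', Finset.mul_sum]
  refine Finset.sum_le_sum fun z hz => ?_
  simp only [hS, Finset.mem_filter, mem_Db] at hz
  have := H r hr z (g z) hz.2 hz.1 (gnn z) (g1 z) (fun y hy => by
      have := g2 z y hy
      split_ifs at this <;> linarith) (fun y hy hne => by
      have := g2 z y hy
      rw [if_neg hne] at this
      linarith) x x' hx hx'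
  have := mul_le_mul_of_nonneg_left this (μ0 z hz.1)
  linarith

lemma harnack1 (hd : 3 ≤ d) : ∃ r1 : ℝ, 1 ≤ r1 ∧ ∃ C : ℝ, 1 ≤ C ∧ ∀ r, r1 ≤ r → ∀ (v : Zd d → ℝ),
    (∀ y, nm y < 25 * r → 0 ≤ v y) → (∀ y, nm y < 25 * r → Av v y = v y) →
    ∀ x x', nm x < r → nm x' < r → v x ≤ C * v x' := by
  obtain ⟨r1, hr1, C, hC, H⟩ := harnack0 hd
  refine ⟨r1, hr1, C, hC, fun r hr v hv hharm x x' hx hx' => ?_⟩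
  have hr0 : 1 ≤ r := by linarith
  have := H r hr (fun y => if nm y < 25 * r then v y else 0) (fun y => by
    split_ifs with h
    · exact hv y h
    · rfl) (fun y hy => by
    have e : Av (fun y => if nm y < 25 * r then v y else 0) y = Av v y := Av_congr fun i =>
      ⟨if_pos (by linarith [(nm_step y i).1]), if_pos (by linarith [(nm_step y i).2.2.1])⟩
    rw [e, hharm y (by linarith), if_pos (by linarith)]) x x' hx hx'
  simpa [(by linarith : nm x < 25 * r), (by linarith : nm x' < 25 * r)] using this

lemma osc (hd : 3 ≤ d) : ∃ r1 : ℝ, 1 ≤ r1 ∧ ∃ C : ℝ, 1 ≤ C ∧ 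
    (∀ r, r1 ≤ r → ∀ (v : Zd d → ℝ), (∀ y, nm y < 25 * r → 0 ≤ v y) → (∀ y, nm y < 25 * r → Av v y = v y) →
      ∀ x x', nm x < r → nm x' < r → v x ≤ C * v x') ∧
    ∀ (k : ℕ) r, r1 ≤ r → ∀ (v : Zd d → ℝ) (l h : ℝ),
    (∀ y, nm y < 25 ^ k * r → l ≤ v y ∧ v y ≤ h ∧ Av v y = v y) →
    ∃ l' h' : ℝ, l ≤ l' ∧ h' - l' ≤ (1 - 1 / C) ^ k * (h - l) ∧ ∀ x, nm x < r → l' ≤ v x ∧ v x ≤ h' := by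
  obtain ⟨r1, hr1, C, hC, H⟩ := harnack1 hd
  refine ⟨r1, hr1, C, hC, H, fun k => ?_⟩
  induction k with
  | zero =>
    intro r hr v l h hv
    exact ⟨l, h, le_rfl, by simp, fun x hx => ⟨(hv x (by simpa using hx)).1, (hv x (by simpa using hx)).2.1⟩⟩
  | succ k ih =>
    intro r hr v l h hv
    have hr0 : 1 ≤ r := by linarith
    obtain ⟨l1, h1, hl1, hh1, hb⟩ := ih (25 * r) (by linarith) v l h (fun y hy => hv y (by
      rw [pow_succ, mul_assoc]; exact hy))
    have hp : (1:ℝ) ≤ 25 ^ k := one_le_pow₀ (by norm_num)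
    have hH := H r hr (fun y => v y - l1) (fun y hy => by linarith [(hb y hy).1]) (fun y hy => by
      rw [Av_sub, Av_const hd, (hv y (by rw [pow_succ, mul_assoc]; nlinarith)).2.2])
    have hne : (Db r : Finset (Zd d)).Nonempty := ⟨0, by rw [mem_Db, nm_zero]; linarith⟩
    obtain ⟨a, ha, hamax⟩ := (Db r).exists_max_image v hne
    obtain ⟨b, hbm, hbmin⟩ := (Db r).exists_min_image v hne
    rw [mem_Db] at ha hbm
    simp only [mem_Db] at hamax hbmin
    have hab := hH a b ha hbm
    have hb1 := hb b (by linarith)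
    have ha1 := hb a (by linarith)
    refine ⟨v b, v a, by linarith, ?_, fun x hx => ⟨hbmin x hx, hamax x hx⟩⟩
    have hC0 : 0 < C := by linarith
    have e1 : (v a - l1) / C ≤ v b - l1 := by rw [div_le_iff₀ hC0]; linarith
    have hθ : 0 ≤ 1 - 1 / C := by
      have : 1 / C ≤ 1 := by rw [div_le_one hC0]; exact hC
      linarith
    calc v a - v b ≤ (v a - l1) - (v a - l1) / C := by linarith
      _ = (1 - 1 / C) * (v a - l1) := by ring
      _ ≤ (1 - 1 / C) * (h1 - l1) := by gcongr; linarith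
      _ ≤ (1 - 1 / C) * ((1 - 1 / C) ^ k * (h - l)) := by gcongr
      _ = _ := by ring

/-- Harnack inequality with constant close to one -/
lemma harnackEps (hd : 3 ≤ d) : ∃ r1 : ℝ, 1 ≤ r1 ∧ ∀ ε : ℝ, 0 < ε → ∃ a : ℝ, 1 ≤ a ∧ ∀ r, r1 ≤ r →
    ∀ v : Zd d → ℝ, (∀ y, 0 ≤ v y) → (∀ y, nm y < a * r → Av v y = v y) →
    ∃ m : ℝ, 0 ≤ m ∧ ∀ x, nm x < r → m ≤ v x ∧ v x ≤ (1 + ε) * m := by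
  obtain ⟨r1, hr1, C, hC, H, O⟩ := osc hd
  refine ⟨r1, hr1, fun ε hε => ?_⟩
  have hC0 : 0 < C := by linarith
  have hθ0 : 0 ≤ 1 - 1 / C := by
    have : 1 / C ≤ 1 := by rw [div_le_one hC0]; exact hC
    linarith
  have hθ1 : 1 - 1 / C < 1 := by
    have : 0 < 1 / C := by positivity
    linarith
  obtain ⟨k, hk⟩ := exists_pow_lt_of_lt_one (by positivity : 0 < ε / C ^ 2) hθ1
  rw [lt_div_iff₀ (by positivity)] at hk
  have hp : (1:ℝ) ≤ 25 ^ k := one_le_pow₀ (by norm_num)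
  refine ⟨25 ^ (k + 1), one_le_pow₀ (by norm_num), fun r hr v hv hh => ?_⟩
  have hr0 : 1 ≤ r := by linarith
  have hR : r1 ≤ 25 ^ k * r := by nlinarith
  have hR' : 25 ^ (k + 1) * r = 25 * (25 ^ k * r) := by ring
  rw [hR'] at hh
  have hH := H (25 ^ k * r) hR v (fun y _ => hv y) hh
  have h0 : nm (0 : Zd d) < 25 ^ k * r := by rw [nm_zero]; linarith
  obtain ⟨l, h, hl, hlh, hb⟩ := O k r hr v (v 0 / C) (C * v 0) fun y hy =>
    ⟨by rw [div_le_iff₀ hC0]; linarith [hH 0 y h0 hy], hH y 0 hy h0, hh y (by linarith)⟩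
  have hv0 := hv 0
  have hl0 : 0 ≤ v 0 / C := by positivity
  refine ⟨l, by linarith, fun x hx => ⟨(hb x hx).1, (hb x hx).2.trans ?_⟩⟩
  have e1 : v 0 ≤ C * l := by
    rw [div_le_iff₀ hC0] at hl; linarith
  have : (1 - 1 / C) ^ k * (C * v 0 - v 0 / C) ≤ ε * l := by
    calc (1 - 1 / C) ^ k * (C * v 0 - v 0 / C) ≤ (1 - 1 / C) ^ k * (C * (C * l)) := by
          gcongr
          have : C * v 0 ≤ C * (C * l) := by gcongr
          linarith
      _ = ((1 - 1 / C) ^ k * C ^ 2) * l := by ring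
      _ ≤ ε * l := by
        have : 0 ≤ l := by linarith
        gcongr
  linarith

end S7

namespace S7
variable {d : ℕ}

lemma mem_ball0 {x : Zd d} {r : ℕ} : x ∈ ball (0 : Zd d) r ↔ ∀ i, (x i).natAbs ≤ r := by
  simp [ball, supDist]

lemma nm_of_ball {x : Zd d} {L : ℕ} (h : x ∈ ball (0 : Zd d) L) : nm x ≤ d * L := by
  rw [mem_ball0] at h
  refine Real.sqrt_le_iff.2 ⟨by positivity, ?_⟩
  have : q2 x ≤ d * (L : ℝ) ^ 2 := by
    refine (Finset.sum_le_card_nsmul _ _ ((L : ℝ) ^ 2) fun i _ => ?_).trans (by simp)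
    rw [sq_le_sq, abs_of_nonneg (Nat.cast_nonneg L : (0:ℝ) ≤ (L:ℝ))]
    have h1 : (((x i).natAbs : ℕ) : ℝ) ≤ L := by exact_mod_cast h i
    rw [Nat.cast_natAbs] at h1
    push_cast at h1
    exact h1
  refine this.trans ?_
  rw [mul_pow]
  have h2 : (d : ℝ) ≤ (d : ℝ) ^ 2 := by exact_mod_cast Nat.le_self_pow (by norm_num) d
  gcongr

lemma ball_of_nm {x : Zd d} {N : ℕ} (h : nm x ≤ N) : x ∈ ball (0 : Zd d) N := by
  rw [mem_ball0]
  intro i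
  have h1 := (abs_le_nm x i).trans h
  have : (((x i).natAbs : ℕ) : ℝ) ≤ N := by rw [Nat.cast_natAbs]; push_cast; exact h1
  exact_mod_cast this

lemma compare (hd : 3 ≤ d) (η : ℝ) (hη : 0 < η) : ∃ c₀ : ℝ, ∀ L K : ℕ, 1 ≤ L → c₀ ≤ (K : ℝ) →
    ∀ A : Set (Zd d), A ⊆ ball 0 L → ∃ p : Zd d → ℝ, (∀ y, 0 ≤ p y) ∧ ∀ u : Zd d → ℝ, (∀ y, 0 ≤ u y) →
      (∀ y ∈ A, u y = 0) → (∀ y ∈ ball (0 : Zd d) (K * L), y ∉ A → Av u y = u y) →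
      ∃ m : ℝ, 0 ≤ m ∧ ∀ y ∈ A, m * (1 - η) * Av p y ≤ Av u y ∧ Av u y ≤ m * (1 + η) * Av p y := by
  obtain ⟨r0, hr0, HF⟩ := escF hd
  obtain ⟨r1, hr1, HH⟩ := harnackEps hd
  obtain ⟨a, ha, HH⟩ := HH (η / 2) (by positivity)
  set s := max r0 r1 with hs
  have hs0 : r0 ≤ s := le_max_left _ _
  have hs1 : r1 ≤ s := le_max_right _ _
  have hd3 : (3:ℝ) ≤ d := by exact_mod_cast hd
  refine ⟨a * (5 * (s * (2 * d))), fun L K hL hK A hA => ?_⟩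
  have hL1 : (1:ℝ) ≤ L := by exact_mod_cast hL
  set ρ := s * (2 * (d * L)) with hρ
  have hdL : (3:ℝ) ≤ d * L := by nlinarith
  have hρs : s ≤ ρ := by nlinarith
  have hρd : d * L < ρ := by nlinarith
  have hρ1 : 1 ≤ ρ := by linarith
  set R := a * (5 * ρ) with hR
  have hRρ : 5 * ρ ≤ R := by nlinarith
  have Anm : ∀ y ∈ A, nm y < ρ := fun y hy => (nm_of_ball (hA hy)).trans_lt hρd
  have Uball : ∀ y, nm y < R → y ∈ ball (0 : Zd d) (K * L) := fun y hy => by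
    apply ball_of_nm
    refine hy.le.trans ?_
    push_cast
    calc R = a * (5 * (s * (2 * d))) * L := by rw [hR, hρ]; ring
      _ ≤ K * L := by gcongr
  obtain ⟨F, F0, F1, Fin1, Fsup, Fhalf⟩ := HF ρ (by linarith)
  obtain ⟨p, p1, p2⟩ := dirichlet hd ((Db R).filter fun y => y ∉ A) (fun y => if y ∈ A then 0 else 1) (fun _ => 0)
  have memU : ∀ y, y ∈ (Db R).filter (fun y => y ∉ A) ↔ nm y < R ∧ y ∉ A := fun y => by simp [mem_Db]
  simp only [memU] at p1 p2
  have pA : ∀ y ∈ A, p y = 0 := fun y hy => by rw [p1 y (by tauto)]; simp [hy]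
  have pR : ∀ y, R ≤ nm y → p y = 1 := fun y hy => by
    rw [p1 y (by intro h; linarith [h.1])]
    have : y ∉ A := fun h => by linarith [Anm y h]
    simp [this]
  have bd : ∀ y, y ∉ (Db R).filter (fun y => y ∉ A) → y ∈ A ∨ R ≤ nm y := fun y hy => by
    rw [memU] at hy
    by_cases h : y ∈ A
    · exact Or.inl h
    · right; by_contra hc; exact hy ⟨not_le.1 hc, h⟩
  have p0 : ∀ y, 0 ≤ p y := by
    refine maxP' hd ((Db R).filter fun y => y ∉ A) (fun _ => 0) p (fun y hy => ?_) (fun y hy => by rw [Av_const hd])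
      (fun y hy => by linarith [p2 y ((memU y).1 hy)])
    rcases bd y hy with h | h
    · rw [pA y h]
    · rw [pR y h]; norm_num
  have hhalf : ∀ y, 4 * ρ ≤ nm y → 1 / 2 ≤ p y := by
    intro y hy
    have : (1 - p y) ≤ F y := by
      refine maxP' hd ((Db R).filter fun y => ρ ≤ nm y) (fun y => 1 - p y) F (fun y hy => ?_) (fun y hy => ?_) (fun y hy => ?_) y
      · simp only [Finset.mem_filter, mem_Db, not_and, not_le] at hy
        by_cases h : nm y < R
        · rw [Fin1 y (hy h)]; linarith [p0 y]
        · rw [pR y (not_lt.1 h)]; linarith [F0 y]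
      · simp only [Finset.mem_filter, mem_Db] at hy
        rw [Av_sub, Av_const hd]
        linarith [p2 y ⟨hy.1, fun h => by linarith [Anm y h]⟩]
      · simp only [Finset.mem_filter, mem_Db] at hy
        exact Fsup y hy.2
    linarith [Fhalf y hy]
  refine ⟨p, p0, fun u u0 uA uh => ?_⟩
  obtain ⟨v, v1, v2⟩ := dirichlet hd (Db R) u (fun _ => 0)
  simp only [mem_Db, not_lt] at v1 v2
  have v0 : ∀ y, 0 ≤ v y := by
    refine maxP' hd (Db R) (fun _ => 0) v (fun y hy => ?_) (fun y hy => by rw [Av_const hd])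
      (fun y hy => by linarith [v2 y (mem_Db.1 hy)])
    rw [v1 y (by simpa [mem_Db] using hy)]
    exact u0 y
  obtain ⟨m, m0, hm⟩ := HH (5 * ρ) (by linarith) v v0 (fun y hy => by linarith [v2 y hy])
  refine ⟨m, m0, ?_⟩
  have wl : ∀ y, m * (1 - p y) ≤ v y - u y := by
    refine maxP' hd ((Db R).filter fun y => y ∉ A) (fun y => m * (1 - p y)) (fun y => v y - u y) (fun y hy => ?_) (fun y hy => ?_) (fun y hy => ?_)
    · rcases bd y hy with h | h
      · rw [pA y h, uA y h]; linarith [(hm y (by linarith [Anm y h])).1]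
      · rw [pR y h, v1 y h]; simp
    · rw [Av_mul, Av_sub, Av_const hd]
      rw [memU] at hy
      apply le_of_eq; congr 1; linarith [p2 y hy]
    · rw [Av_sub]
      rw [memU] at hy
      rw [uh y (Uball y hy.1) hy.2]
      linarith [v2 y hy.1]
  have wu : ∀ y, v y - u y ≤ (1 + η / 2) * m * (1 - p y) := by
    refine maxP' hd ((Db R).filter fun y => y ∉ A) (fun y => v y - u y) (fun y => (1 + η / 2) * m * (1 - p y)) (fun y hy => ?_) (fun y hy => ?_) (fun y hy => ?_)
    · rcases bd y hy with h | h
      · rw [pA y h, uA y h]; linarith [(hm y (by linarith [Anm y h])).2]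
      · rw [pR y h, v1 y h]; simp
    · rw [Av_sub]
      rw [memU] at hy
      rw [uh y (Uball y hy.1) hy.2]
      linarith [v2 y hy.1]
    · rw [Av_mul, Av_sub, Av_const hd]
      rw [memU] at hy
      apply le_of_eq; congr 1; linarith [p2 y hy]
  have memD : ∀ y, y ∈ (Db (4 * ρ)).filter (fun y => y ∉ A) ↔ nm y < 4 * ρ ∧ y ∉ A := fun y => by simp [mem_Db]
  have hN : ∀ y ∈ (Db (4 * ρ)).filter (fun y => y ∉ A), ∀ i, y + ev i ∈ {y : Zd d | nm y < 5 * ρ} ∧ y - ev i ∈ {y : Zd d | nm y < 5 * ρ} := by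
    intro y hy i
    rw [memD] at hy
    simp only [mem_ofPred_eq]
    constructor
    · linarith [(nm_step y i).1]
    · linarith [(nm_step y i).2.2.1]
  have bd' : ∀ y, y ∉ (Db (4 * ρ)).filter (fun y => y ∉ A) → y ∈ A ∨ 4 * ρ ≤ nm y := fun y hy => by
    rw [memD] at hy
    by_cases h : y ∈ A
    · exact Or.inl h
    · right; by_contra hc; exact hy ⟨not_le.1 hc, h⟩
  have hηm : 0 ≤ η * m := by positivity
  have up : ∀ y ∈ (Db (4 * ρ)).filter (fun y => y ∉ A), u y - m * (1 + η) * p y ≤ 0 := by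
    refine maxP hd ((Db (4 * ρ)).filter fun y => y ∉ A) {y : Zd d | nm y < 5 * ρ} (fun y => u y - m * (1 + η) * p y) hN (fun y hyE hy => ?_) (fun y hy => ?_)
    · simp only [mem_ofPred_eq] at hyE
      rcases bd' y hy with h | h
      · rw [pA y h, uA y h]; simp
      · have h1 := wl y
        have h2 := (hm y hyE).2
        have h3 := mul_le_mul_of_nonneg_left (hhalf y h) hηm
        linarith
    · rw [memD] at hy
      rw [Av_sub, Av_mul, uh y (Uball y (by linarith)) hy.2]
      rw [show Av p y = p y by linarith [p2 y ⟨by linarith, hy.2⟩]]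
  have lo : ∀ y ∈ (Db (4 * ρ)).filter (fun y => y ∉ A), m * (1 - η) * p y - u y ≤ 0 := by
    refine maxP hd ((Db (4 * ρ)).filter fun y => y ∉ A) {y : Zd d | nm y < 5 * ρ} (fun y => m * (1 - η) * p y - u y) hN (fun y hyE hy => ?_) (fun y hy => ?_)
    · simp only [mem_ofPred_eq] at hyE
      rcases bd' y hy with h | h
      · rw [pA y h, uA y h]; simp
      · have h1 := wu y
        have h2 := (hm y hyE).1
        have h3 := mul_le_mul_of_nonneg_left (hhalf y h) hηm
        have h4 := mul_nonneg hηm (p0 y)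
        linarith
    · rw [memD] at hy
      rw [Av_sub, Av_mul, uh y (Uball y (by linarith)) hy.2]
      rw [show Av p y = p y by linarith [p2 y ⟨by linarith, hy.2⟩]]
  have both : ∀ y, nm y < 4 * ρ → m * (1 - η) * p y ≤ u y ∧ u y ≤ m * (1 + η) * p y := fun y hy => by
    by_cases h : y ∈ A
    · rw [pA y h, uA y h]; simp
    · have hD := (memD y).2 ⟨hy, h⟩
      constructor
      · linarith [lo y hD]
      · linarith [up y hD]
  intro y hy
  have hy1 := Anm y hy
  have n1 : ∀ i, nm (y + ev i) < 4 * ρ := fun i => by linarith [(nm_step y i).1]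
  have n2 : ∀ i, nm (y - ev i) < 4 * ρ := fun i => by linarith [(nm_step y i).2.2.1]
  rw [← Av_mul, ← Av_mul]
  exact ⟨Av_mono fun i => ⟨(both _ (n1 i)).1, (both _ (n2 i)).1⟩, Av_mono fun i => ⟨(both _ (n1 i)).2, (both _ (n2 i)).2⟩⟩

end S7

namespace S7
variable {d : ℕ}

def uv (a : Fin d × Bool) : Zd d := if a.2 then ev a.1 else - ev a.1

lemma uv_inj : Function.Injective (uv : Fin d × Bool → Zd d) := by
  rintro ⟨i, b⟩ ⟨j, c⟩ h
  have h1 := congrFun h i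
  have h2 := congrFun h j
  by_cases hij : i = j
  · subst hij
    cases b <;> cases c <;> simp [uv, ev] at h1 ⊢
  · cases b <;> cases c <;> simp [uv, ev, hij] at h1

lemma stepP_uv (a : Fin d × Bool) : stepP d (uv a) = ((2 * d : ℕ) : ℝ≥0∞)⁻¹ := by
  have : (∑ i, (uv a i).natAbs) = 1 := by
    rcases a with ⟨i, b⟩
    rw [Finset.sum_eq_single i]
    · cases b <;> simp [uv, ev]
    · intro j _ hj; cases b <;> simp [uv, ev, hj]
    · simp
  simp [stepP, this]

noncomputable def kn (B : Set (Zd d)) : ℕ → Zd d → ℝ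
  | 0 => fun _ => 1
  | n + 1 => fun x => Av (fun y => if y ∈ B then 0 else kn B n y) x

def good (B : Set (Zd d)) : (n : ℕ) → Zd d → (Fin n → Fin d × Bool) → Prop
  | 0, _, _ => True
  | n + 1, x, t => x + uv (t 0) ∉ B ∧ good B n (x + uv (t 0)) (Fin.tail t)

lemma good_iff (B : Set (Zd d)) (n : ℕ) : ∀ (y : ℕ → Zd d) (t : Fin n → Fin d × Bool),
    (∀ i : Fin n, y (i + 1) - y i = uv (t i)) → (good B n (y 0) t ↔ ∀ j, 1 ≤ j → j ≤ n → y j ∉ B) := by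
  induction n with
  | zero => intro y t _; simp only [good, true_iff]; intro j h1 h2; omega
  | succ n ih =>
    intro y t h
    have h0 : y 0 + uv (t 0) = y 1 := by
      have := h 0
      simp only [Fin.val_zero, zero_add] at this
      rw [← this]; abel
    simp only [good, h0]
    rw [ih (fun k => y (k + 1)) (Fin.tail t) (fun i => by
      have := h i.succ
      simpa [Fin.tail] using this)]
    constructor
    · rintro ⟨a, b⟩ j h1 h2
      rcases Nat.lt_or_ge 1 j with h3 | h3
      · have := b (j - 1) (by omega) (by omega)
        rwa [Nat.sub_add_cancel h1] at this
      · rwa [show j = 1 by omega]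
    · intro a
      exact ⟨a 1 le_rfl (by omega), fun j h1 h2 => a (j + 1) (by omega) (by omega)⟩

lemma Av_uv (f : Zd d → ℝ) (x : Zd d) : Av f x = (∑ a, f (x + uv a)) / (2 * d) := by
  simp [Av, Fintype.sum_prod_type, uv, sub_eq_add_neg]

lemma kn_eq (hd : 3 ≤ d) (B : Set (Zd d)) (n : ℕ) : ∀ x : Zd d,
    (∑ t : Fin n → Fin d × Bool, if good B n x t then (1:ℝ) else 0) * ((2 * d : ℝ)⁻¹) ^ n = kn B n x := by
  induction n with
  | zero => intro x; simp [good, kn]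
  | succ n ih =>
    intro x
    have hd0 : (d : ℝ) ≠ 0 := by positivity
    simp only [kn]
    rw [Av_uv]
    rw [← (Fin.consEquiv (fun _ => Fin d × Bool)).sum_comp, Fintype.sum_prod_type]
    rw [div_eq_mul_inv, pow_succ, ← mul_assoc]
    congr 1
    rw [Finset.sum_mul]
    refine Finset.sum_congr rfl fun a _ => ?_
    have : ∀ t : Fin n → Fin d × Bool, good B (n + 1) x (Fin.consEquiv (fun _ => Fin d × Bool) (a, t)) ↔ x + uv a ∉ B ∧ good B n (x + uv a) t := fun t => by
      simp [good, Fin.consEquiv]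
    simp only [this]
    by_cases h : x + uv a ∈ B
    · simp [h]
    · simp only [h, not_false_eq_true, true_and, if_false]
      exact ih _

lemma exp_univ : expMeasure univ = 1 := by
  have := ProbabilityTheory.lintegral_exponentialPDF_eq_one (r := 1) (by norm_num)
  rw [← this, expMeasure, withDensity_apply _ MeasurableSet.univ, setLIntegral_univ]
  apply lintegral_congr_ae
  have : ∀ᵐ t : ℝ, t ≠ 0 := by simp [ae_iff]
  filter_upwards [this] with t ht
  rw [ProbabilityTheory.exponentialPDF_eq]
  rcases lt_or_gt_of_ne ht with h | h
  · simp [not_le.2 h, not_lt.2 h.le]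
  · simp [h, h.le]

lemma exp_nonpos : expMeasure (Iic 0) = 0 := by
  rw [expMeasure, withDensity_apply _ measurableSet_Iic]
  rw [setLIntegral_congr_fun (g := fun _ => 0) measurableSet_Iic]
  · simp
  · intro t ht
    simp at ht
    simp [not_lt.2 ht]

lemma exp_le_one : expMeasure (Iic 1) < 1 := by
  have h0 : expMeasure (Ioi 1) ≠ 0 := by
    rw [expMeasure, withDensity_apply _ measurableSet_Ioi]
    intro h
    have hm : Measurable fun t : ℝ => ENNReal.ofReal (if 0 < t then Real.exp (-t) else 0) :=
      ENNReal.measurable_ofReal.comp (Measurable.ite measurableSet_Ioi (by fun_prop) measurable_const)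
    rw [lintegral_eq_zero_iff hm] at h
    have h2 := (ae_restrict_iff' measurableSet_Ioi).1 h
    have h3 : ∀ᵐ t : ℝ, t ∉ Ioi (1:ℝ) := by
      filter_upwards [h2] with t ht h1
      have := ht h1
      simp only [Pi.zero_apply, ofReal_eq_zero] at this
      rw [if_pos (by simp at h1; linarith)] at this
      exact absurd this (not_le.2 (Real.exp_pos _))
    rw [← measure_eq_zero_iff_ae_notMem] at h3
    simp at h3
  have : IsProbabilityMeasure expMeasure := ⟨exp_univ⟩
  have := prob_compl_eq_one_sub (μ := expMeasure) (s := Ioi 1) measurableSet_Ioi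
  rw [compl_Ioi] at this
  rw [this]
  exact ENNReal.sub_lt_self (by simp) (by simp) h0

variable {Ω : Type*} [MeasurableSpace Ω]

def cyl (W : SRW d Ω) (n : ℕ) (t : Fin n → Fin d × Bool) : Set Ω :=
  {ω | ∀ i : Fin n, W.Y ((i : ℕ) + 1) ω - W.Y (i : ℕ) ω = uv (t i)}

lemma cyl_meas (W : SRW d Ω) (n : ℕ) (t : Fin n → Fin d × Bool) : MeasurableSet (cyl W n t) := by
  have : cyl W n t = ⋂ i : Fin n, {ω | W.Y ((i : ℕ) + 1) ω - W.Y (i : ℕ) ω = uv (t i)} := by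
    ext; simp [cyl]
  rw [this]
  refine MeasurableSet.iInter fun i => ?_
  exact ((W.measurable_Y _).sub (W.measurable_Y _)) (measurableSet_singleton _)

lemma cyl_law (W : SRW d Ω) (x : Zd d) (n : ℕ) (t : Fin n → Fin d × Bool) (I : Fin n → Set ℝ)
    (hI : ∀ i, MeasurableSet (I i)) :
    W.P x ({ω | ∀ i : Fin n, W.ζ i ω ∈ I i} ∩ cyl W n t) = (((2 * d : ℕ) : ℝ≥0∞)⁻¹) ^ n * ∏ i, expMeasure (I i) := by
  have := W.law x n (fun i => uv (t i)) I hI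
  simp only [stepP_uv, Finset.prod_const, Finset.card_univ, Fintype.card_fin] at this
  rw [← this]
  congr 1
  ext ω
  simp [cyl, and_comm]

lemma cyl_law' (W : SRW d Ω) (x : Zd d) (n : ℕ) (t : Fin n → Fin d × Bool) :
    W.P x (cyl W n t) = (((2 * d : ℕ) : ℝ≥0∞)⁻¹) ^ n := by
  have := cyl_law W x n t (fun _ => univ) (fun _ => MeasurableSet.univ)
  simpa [exp_univ] using this

lemma cyl_disj (W : SRW d Ω) (n : ℕ) : Pairwise (Function.onFun Disjoint (cyl W n)) := by
  intro s t hst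
  rw [Function.onFun, Set.disjoint_left]
  intro ω h1 h2
  exact hst (funext fun i => uv_inj ((h1 i).symm.trans (h2 i)))

lemma sum_one (hd : 3 ≤ d) (n : ℕ) : ∑ _t : Fin n → Fin d × Bool, (((2 * d : ℕ) : ℝ≥0∞)⁻¹) ^ n = 1 := by
  have h0 : ((2 * d : ℕ) : ℝ≥0∞) ≠ 0 := by simp; omega
  rw [Finset.sum_const, Finset.card_univ, nsmul_eq_mul]
  have : (Fintype.card (Fin n → Fin d × Bool) : ℝ≥0∞) = ((2 * d : ℕ) : ℝ≥0∞) ^ n := by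
    simp [mul_comm]
  rw [this, ← mul_pow, ENNReal.mul_inv_cancel h0 (by exact natCast_ne_top _), one_pow]

lemma part (hd : 3 ≤ d) (W : SRW d Ω) (x : Zd d) (n : ℕ) (G : Set Ω) (hG : MeasurableSet G) :
    W.P x G = ∑ t, W.P x (G ∩ cyl W n t) := by
  have := W.isProb x
  have h1 : W.P x (⋃ t, cyl W n t) = 1 := by
    rw [measure_iUnion (cyl_disj W n) (cyl_meas W n), tsum_fintype]
    simp only [cyl_law', sum_one hd n]
  have h2 : W.P x G = W.P x (G ∩ ⋃ t, cyl W n t) := by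
    have h3 : ∀ᵐ ω ∂ W.P x, ω ∈ ⋃ t, cyl W n t :=
      (mem_ae_iff_prob_eq_one (MeasurableSet.iUnion (cyl_meas W n))).2 h1
    apply measure_congr
    filter_upwards [h3] with ω hω
    exact propext ⟨fun h => ⟨h, hω⟩, fun h => h.1⟩
  rw [h2, inter_iUnion, measure_iUnion _ (fun t => hG.inter (cyl_meas W n t)), tsum_fintype]
  exact fun s t hst => (cyl_disj W n hst).mono inter_subset_right inter_subset_right

lemma zlaw (hd : 3 ≤ d) (W : SRW d Ω) (x : Zd d) (n : ℕ) (I : Fin n → Set ℝ)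
    (hI : ∀ i, MeasurableSet (I i)) : W.P x {ω | ∀ i : Fin n, W.ζ i ω ∈ I i} = ∏ i, expMeasure (I i) := by
  rw [part hd W x n]
  · simp only [cyl_law W x n _ I hI]
    rw [← Finset.sum_mul, sum_one hd, one_mul]
  · have : {ω | ∀ i : Fin n, W.ζ i ω ∈ I i} = ⋂ i : Fin n, (W.ζ i) ⁻¹' I i := by ext; simp
    rw [this]
    exact MeasurableSet.iInter fun i => W.measurable_ζ _ (hI i)

lemma zpos (hd : 3 ≤ d) (W : SRW d Ω) (x : Zd d) : ∀ᵐ ω ∂ W.P x, ∀ i, 0 < W.ζ i ω := by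
  rw [ae_all_iff]
  intro i
  rw [ae_iff]
  have := zlaw hd W x (i + 1) (fun j => if j = Fin.last i then Iic 0 else univ)
    (fun j => by split_ifs <;> measurability)
  rw [Finset.prod_eq_zero (Finset.mem_univ (Fin.last i)) (by simp [exp_nonpos])] at this
  refine measure_mono_null ?_ this
  intro ω hω
  simp only [not_lt, mem_ofPred_eq] at hω ⊢
  intro j
  split_ifs with h
  · subst h; simpa using hω
  · trivial

lemma zfreq (hd : 3 ≤ d) (W : SRW d Ω) (x : Zd d) : ∀ᵐ ω ∂ W.P x, ∀ m, ∃ i, m ≤ i ∧ 1 < W.ζ i ω := by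
  rw [ae_all_iff]
  intro m
  rw [ae_iff]
  have h : ∀ n : ℕ, W.P x {ω | ¬ ∃ i, m ≤ i ∧ 1 < W.ζ i ω} ≤ expMeasure (Iic 1) ^ n := by
    intro n
    have := zlaw hd W x (m + n) (fun j => if (j : ℕ) < m then univ else Iic 1)
      (fun j => by split_ifs <;> measurability)
    rw [Fin.prod_univ_add] at this
    simp [exp_univ] at this
    rw [← this]
    apply measure_mono
    intro ω hω
    simp only [not_exists, not_and, not_lt, mem_ofPred_eq] at hω ⊢
    exact fun j h => hω _ h
  refine le_antisymm (ge_of_tendsto' (ENNReal.tendsto_pow_atTop_nhds_zero_of_lt_one exp_le_one) h) (by simp)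

lemma hit_iff (W : SRW d Ω) (B : Set (Zd d)) (ω : Ω) (h0 : ∀ i, 0 < W.ζ i ω)
    (h1 : ∀ m, ∃ i, m ≤ i ∧ 1 < W.ζ i ω) : W.hitTilde B ω = ⊤ ↔ ∀ n, 1 ≤ n → W.Y n ω ∉ B := by
  have Sm : StrictMono fun n => W.S n ω := strictMono_nat_of_lt_succ fun n => by
    simp only [SRW.S, Finset.sum_range_succ]; linarith [h0 n]
  have S0 : W.S 0 ω = 0 := by simp [SRW.S]
  have S1 : W.S 1 ω = W.ζ 0 ω := by simp [SRW.S]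
  have Su : ∀ M : ℕ, ∃ n, (M : ℝ) ≤ W.S n ω := by
    intro M
    induction M with
    | zero => exact ⟨0, by simp [S0]⟩
    | succ M ih =>
      obtain ⟨n, hn⟩ := ih
      obtain ⟨i, hi, hi1⟩ := h1 n
      refine ⟨i + 1, ?_⟩
      have h2 : W.S n ω ≤ W.S i ω := Sm.monotone hi
      have h3 : W.S (i + 1) ω = W.S i ω + W.ζ i ω := by simp only [SRW.S, Finset.sum_range_succ]
      push_cast; linarith
  have bdd : ∀ t : ℝ, BddAbove {k : ℕ | W.S k ω ≤ t} := by
    intro t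
    obtain ⟨n, hn⟩ := Su (⌈t⌉₊)
    refine ⟨n, fun k hk => ?_⟩
    have : W.S k ω ≤ W.S n ω := le_trans hk ((Nat.le_ceil t).trans hn)
    exact Sm.le_iff_le.1 this
  rw [SRW.hitTilde, SRW.hitFrom, sInf_eq_top]
  constructor
  · intro h n hn hB
    have hS : 0 ≤ W.S n ω := by rw [← S0]; exact Sm.monotone (Nat.zero_le n)
    have hj : W.jumpIdx (W.S n ω) ω = n := by
      have : {k : ℕ | W.S k ω ≤ W.S n ω} = Iic n := by
        ext k; exact Sm.le_iff_le
      rw [SRW.jumpIdx, this, csSup_Iic]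
    have := h _ ⟨Real.toNNReal (W.S n ω), rfl, ?_, ?_⟩
    · exact coe_ne_top this
    · rw [← S1]
      exact ENNReal.ofReal_le_ofReal (Sm.monotone hn)
    · rw [SRW.X]
      rw [Real.coe_toNNReal _ hS, hj]
      exact hB
  · rintro h u ⟨s, rfl, h2, h3⟩
    exfalso
    refine h _ ?_ h3
    refine le_csSup (bdd _) ?_
    rw [mem_ofPred_eq, S1]
    rw [ENNReal.ofReal_le_iff_le_toReal coe_ne_top] at h2
    exact h2

def En (W : SRW d Ω) (B : Set (Zd d)) (n : ℕ) : Set Ω := {ω | ∀ j, 1 ≤ j → j ≤ n → W.Y j ω ∉ B}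

lemma En_meas (W : SRW d Ω) (B : Set (Zd d)) (n : ℕ) : MeasurableSet (En W B n) := by
  have : En W B n = ⋂ (j : ℕ) (_ : 1 ≤ j) (_ : j ≤ n), (W.Y j) ⁻¹' Bᶜ := by ext; simp [En]
  rw [this]
  refine MeasurableSet.iInter fun j => MeasurableSet.iInter fun _ => MeasurableSet.iInter fun _ => ?_
  exact W.measurable_Y _ (Set.to_countable _).measurableSet

lemma En_law (hd : 3 ≤ d) (W : SRW d Ω) (B : Set (Zd d)) (n : ℕ) (x : Zd d) :
    (W.P x (En W B n)).toReal = kn B n x := by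
  have := W.isProb x
  have h : ∀ t, W.P x (En W B n ∩ cyl W n t) = if good B n x t then (((2 * d : ℕ) : ℝ≥0∞)⁻¹) ^ n else 0 := by
    intro t
    have hY : ∀ᵐ ω ∂ W.P x, W.Y 0 ω = x := by
      have := (mem_ae_iff_prob_eq_one (μ := W.P x) (s := {ω | W.Y 0 ω = x}) ((W.measurable_Y 0) (measurableSet_singleton x))).2 (W.Y_zero x)
      exact this
    split_ifs with hg
    · rw [← cyl_law' W x n t]
      apply measure_congr
      filter_upwards [hY] with ω hω
      apply propext
      refine ⟨fun h => h.2, fun h => ⟨?_, h⟩⟩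
      have := good_iff B n (fun k => W.Y k ω) t h
      rw [hω] at this
      exact this.1 hg
    · rw [← measure_empty (μ := W.P x)]
      apply measure_congr
      filter_upwards [hY] with ω hω
      apply propext
      refine ⟨fun h => ?_, fun h => h.elim⟩
      have := good_iff B n (fun k => W.Y k ω) t h.2
      rw [hω] at this
      exact hg (this.2 h.1)
  rw [part hd W x n _ (En_meas W B n), ENNReal.toReal_sum (fun t _ => measure_ne_top _ _), ← kn_eq hd, Finset.sum_mul]
  refine Finset.sum_congr rfl fun t _ => ?_
  rw [h t]
  split_ifs <;> simp

lemma eqm_lim (hd : 3 ≤ d) (W : SRW d Ω) (B : Set (Zd d)) : ∃ k : Zd d → ℝ,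
    (∀ x, Filter.Tendsto (fun n => kn B n x) Filter.atTop (nhds (k x))) ∧ ∀ x ∈ B, W.eqm B x = k x := by
  refine ⟨fun x => (W.P x (⋂ n, En W B n)).toReal, fun x => ?_, fun x hx => ?_⟩
  · have := W.isProb x
    simp only [← En_law hd W]
    refine (ENNReal.tendsto_toReal (measure_ne_top _ _)).comp ?_
    refine tendsto_measure_iInter_atTop (fun n => (En_meas W B n).nullMeasurableSet) ?_ ⟨0, measure_ne_top _ _⟩
    intro m n hmn ω h j h1 h2
    exact h j h1 (h2.trans hmn)
  · rw [SRW.eqm, if_pos hx]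
    congr 1
    apply measure_congr
    filter_upwards [zpos hd W x, zfreq hd W x] with ω a b
    apply propext
    refine (hit_iff W B ω a b).trans ?_
    change _ ↔ ω ∈ ⋂ n, En W B n
    simp only [mem_iInter, En, mem_ofPred_eq]
    exact ⟨fun h n j h1 _ => h j h1, fun h n h1 => h n n h1 le_rfl⟩

end S7

namespace S7
variable {d : ℕ} {Ω : Type*} [MeasurableSpace Ω]

lemma kn_nonneg (B : Set (Zd d)) (n : ℕ) : ∀ x, 0 ≤ kn B n x := by
  induction n with
  | zero => intro x; simp [kn]
  | succ n ih =>
    intro x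
    simp only [kn, Av]
    have : ∀ y, 0 ≤ (if y ∈ B then 0 else kn B n y) := fun y => by split_ifs; exacts [le_rfl, ih y]
    exact div_nonneg (Finset.sum_nonneg fun i _ => add_nonneg (this _) (this _)) (by positivity)

lemma kn_anti {A B : Set (Zd d)} (h : A ⊆ B) (n : ℕ) : ∀ x, kn B n x ≤ kn A n x := by
  induction n with
  | zero => intro x; simp [kn]
  | succ n ih =>
    intro x
    simp only [kn]
    have : ∀ y, (if y ∈ B then 0 else kn B n y) ≤ (if y ∈ A then 0 else kn A n y) := fun y => by
      by_cases hA : y ∈ A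
      · simp [hA, h hA]
      · by_cases hB : y ∈ B
        · simp [hA, hB, kn_nonneg]
        · simp [hA, hB, ih]
    exact Av_mono fun i => ⟨this _, this _⟩

lemma kn_esc (hd : 3 ≤ d) (B : Set (Zd d)) (F : Zd d → ℝ) (ρ : ℝ) (F0 : ∀ y, 0 ≤ F y)
    (F1 : ∀ y, nm y < ρ → F y = 1) (Fs : ∀ y, ρ ≤ nm y → Av F y ≤ F y) (hB : ∀ y ∈ B, nm y < ρ) (n : ℕ) :
    ∀ x, 1 - F x ≤ (if x ∈ B then 0 else kn B n x) := by
  induction n with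
  | zero =>
    intro x
    by_cases h : x ∈ B
    · simp [h, F1 x (hB x h)]
    · simp [h, kn, F0]
  | succ n ih =>
    intro x
    by_cases h : x ∈ B
    · simp [h, F1 x (hB x h)]
    · rw [if_neg h]
      by_cases hx : nm x < ρ
      · rw [F1 x hx]; simpa using kn_nonneg B (n + 1) x
      · simp only [kn]
        have h1 : Av (fun y => 1 - F y) x ≤ Av (fun y => if y ∈ B then 0 else kn B n y) x :=
          Av_mono fun i => ⟨ih _, ih _⟩
        rw [Av_sub, Av_const hd] at h1
        linarith [Fs x (not_lt.1 hx)]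

lemma adj_ev {x y : Zd d} (h : adjacent x y) : ∃ i, y = x + ev i ∨ y = x - ev i := by
  unfold adjacent at h
  obtain ⟨i, hi⟩ : ∃ i, (x i - y i).natAbs ≠ 0 := by
    by_contra hc
    push Not at hc
    simp [hc] at h
  have h1 : (x i - y i).natAbs + ∑ j ∈ Finset.univ.erase i, (x j - y j).natAbs = 1 := by
    rw [Finset.add_sum_erase _ (fun j => (x j - y j).natAbs) (Finset.mem_univ i)]; exact h
  have h2 : ∑ j ∈ Finset.univ.erase i, (x j - y j).natAbs = 0 := by omega
  have h3 : ∀ j, j ≠ i → x j = y j := fun j hj => by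
    have := (Finset.sum_eq_zero_iff.1 h2) j (by simp [hj])
    omega
  have h4 : (x i - y i).natAbs = 1 := by omega
  refine ⟨i, ?_⟩
  rcases (by omega : y i = x i + 1 ∨ y i = x i - 1) with h5 | h5
  · left; funext j
    by_cases hj : j = i
    · subst hj; simp [ev, h5]
    · simp [ev, hj, h3 j hj]
  · right; funext j
    by_cases hj : j = i
    · subst hj; simp [ev, h5]
    · simp [ev, hj, h3 j hj]

lemma Av_tendsto (f : ℕ → Zd d → ℝ) (g : Zd d → ℝ)
    (h : ∀ x, Filter.Tendsto (fun n => f n x) Filter.atTop (nhds (g x))) (x : Zd d) :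
    Filter.Tendsto (fun n => Av (f n) x) Filter.atTop (nhds (Av g x)) := by
  unfold Av
  exact (tendsto_finsetSum _ fun i _ => (h _).add (h _)).div_const _

/-- escape function off `B` -/
lemma hfun (hd : 3 ≤ d) (W : SRW d Ω) (B : Set (Zd d)) : ∃ h : Zd d → ℝ, (∀ x, 0 ≤ h x) ∧
    (∀ x ∈ B, h x = 0) ∧ (∀ x ∉ B, Av h x = h x) ∧ (∀ x ∈ B, W.eqm B x = Av h x) ∧
    (∀ x, Filter.Tendsto (fun n => if x ∈ B then 0 else kn B n x) Filter.atTop (nhds (h x))) := by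
  obtain ⟨k, k1, k2⟩ := eqm_lim hd W B
  have ht : ∀ x, Filter.Tendsto (fun n => if x ∈ B then 0 else kn B n x) Filter.atTop (nhds (if x ∈ B then 0 else k x)) := by
    intro x
    by_cases h : x ∈ B
    · simp [h]
    · simpa [h] using k1 x
  have hk : ∀ x, Av (fun x => if x ∈ B then 0 else k x) x = k x := fun x => by
    have h1 := Av_tendsto _ _ ht x
    have h2 := (Filter.tendsto_add_atTop_iff_nat 1).2 (k1 x)
    exact tendsto_nhds_unique h1 h2
  refine ⟨fun x => if x ∈ B then 0 else k x, fun x => ?_, fun x hx => by simp [hx], fun x hx => ?_, fun x hx => ?_, ht⟩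
  · refine ge_of_tendsto' (ht x) fun n => ?_
    split_ifs
    exacts [le_rfl, kn_nonneg B n x]
  · rw [hk]; simp [hx]
  · rw [hk, k2 x hx]

lemma h_pos (hd : 3 ≤ d) (B : Set (Zd d)) (hB : B.Finite) (hc : connSet Bᶜ) (h : Zd d → ℝ) (h0 : ∀ x, 0 ≤ h x)
    (hh : ∀ x ∉ B, Av h x = h x)
    (ht : ∀ x, Filter.Tendsto (fun n => if x ∈ B then 0 else kn B n x) Filter.atTop (nhds (h x))) :
    ∀ x ∉ B, 0 < h x := by
  obtain ⟨r0, hr0, HF⟩ := escF hd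
  obtain ⟨M, hM⟩ := (hB.image nm).bddAbove
  set ρ := max r0 (M + 1) with hρ
  have hρ1 : 1 ≤ ρ := hr0.trans (le_max_left _ _)
  have Bρ : ∀ y ∈ B, nm y < ρ := fun y hy => by
    have := hM (Set.mem_image_of_mem nm hy)
    linarith [le_max_right r0 (M + 1)]
  obtain ⟨F, F0, F1, Fin1, Fsup, Fhalf⟩ := HF ρ (le_max_left _ _)
  have i0 : Fin d := ⟨0, by omega⟩
  obtain ⟨N, hN⟩ := exists_nat_ge (4 * ρ)
  let z : Zd d := Pi.single i0 (N : ℤ)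
  have hz : 4 * ρ ≤ nm z := by
    have := abs_le_nm z i0
    simp [z] at this
    linarith
  have zB : z ∉ B := fun h => by linarith [Bρ z h]
  have hz0 : 0 < h z := by
    have : 1 - F z ≤ h z := ge_of_tendsto' (ht z) fun n => kn_esc hd B F ρ F0 Fin1 Fsup Bρ n z
    linarith [Fhalf z hz]
  intro x hx
  obtain ⟨n, f, f0, fn, fB, fa⟩ := hc z zB x hx
  have : ∀ k ≤ n, 0 < h (f k) := by
    intro k
    induction k with
    | zero => intro _; rw [f0]; exact hz0
    | succ k ih =>
      intro hk
      have h1 := ih (by omega)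
      rw [← hh _ (fB (k + 1) hk)]
      have hd0 : (0:ℝ) < 2 * d := by positivity
      obtain ⟨i, hi | hi⟩ := adj_ev (fa k (by omega))
      · have h2 := (Av_ge h0 (f (k + 1)) i).2
        rw [hi, add_sub_cancel_right] at h2
        rw [hi]
        exact lt_of_lt_of_le (by positivity) h2
      · have h2 := (Av_ge h0 (f (k + 1)) i).1
        rw [hi, sub_add_cancel] at h2
        rw [hi]
        exact lt_of_lt_of_le (by positivity) h2
  rw [← fn]; exact this n le_rfl

lemma ratio (δ : ℝ) (h0 : 0 < δ) (h1 : δ < 1) (A : Finset (Zd d)) (a b t : Zd d → ℝ) (mA mB : ℝ)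
    (hmA : 0 ≤ mA) (hmB : 0 ≤ mB) (ht : ∀ y ∈ A, 0 ≤ t y)
    (ha : ∀ y ∈ A, mA * (1 - δ / 100) * t y ≤ a y ∧ a y ≤ mA * (1 + δ / 100) * t y)
    (hb : ∀ y ∈ A, mB * (1 - δ / 100) * t y ≤ b y ∧ b y ≤ mB * (1 + δ / 100) * t y)
    (sa : 0 < ∑ y ∈ A, a y) (sb : 0 < ∑ y ∈ A, b y) (y : Zd d) (hy : y ∈ A) :
    (1 - δ / 10) * (a y / ∑ y ∈ A, a y) ≤ b y / ∑ y ∈ A, b y ∧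
    b y / ∑ y ∈ A, b y ≤ (1 + δ / 10) * (a y / ∑ y ∈ A, a y) := by
  set T := ∑ y ∈ A, t y with hT
  have T0 : 0 ≤ T := Finset.sum_nonneg ht
  have hsa : mA * (1 - δ / 100) * T ≤ ∑ y ∈ A, a y ∧ ∑ y ∈ A, a y ≤ mA * (1 + δ / 100) * T := by
    rw [hT, Finset.mul_sum, Finset.mul_sum]
    exact ⟨Finset.sum_le_sum fun y hy => (ha y hy).1, Finset.sum_le_sum fun y hy => (ha y hy).2⟩
  have hsb : mB * (1 - δ / 100) * T ≤ ∑ y ∈ A, b y ∧ ∑ y ∈ A, b y ≤ mB * (1 + δ / 100) * T := by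
    rw [hT, Finset.mul_sum, Finset.mul_sum]
    exact ⟨Finset.sum_le_sum fun y hy => (hb y hy).1, Finset.sum_le_sum fun y hy => (hb y hy).2⟩
  obtain ⟨a1, a2⟩ := ha y hy
  obtain ⟨b1, b2⟩ := hb y hy
  have t0 := ht y hy
  set sA := ∑ y ∈ A, a y
  set sB := ∑ y ∈ A, b y
  have p : 0 ≤ mA * mB * t y * T := by positivity
  have e1 : 0 ≤ 1 - δ / 100 := by linarith
  have e2 : 0 ≤ 1 + δ / 100 := by linarith
  have c1 : (1 - δ / 10) * (1 + δ / 100) ^ 2 ≤ (1 - δ / 100) ^ 2 := by nlinarith [sq_nonneg δ, mul_pos h0 h0, mul_pos h0 (mul_pos h0 h0)]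
  have c2 : (1 + δ / 100) ^ 2 ≤ (1 + δ / 10) * (1 - δ / 100) ^ 2 := by nlinarith [sq_nonneg δ, mul_pos h0 h0, mul_pos h0 (mul_pos h0 h0)]
  have q1 := mul_le_mul_of_nonneg_right c1 p
  have q2 := mul_le_mul_of_nonneg_right c2 p
  have u1 : a y * sB ≤ (mA * (1 + δ / 100) * t y) * (mB * (1 + δ / 100) * T) := mul_le_mul a2 hsb.2 sb.le (by positivity)
  have u2 : b y * sA ≤ (mB * (1 + δ / 100) * t y) * (mA * (1 + δ / 100) * T) := mul_le_mul b2 hsa.2 sa.le (by positivity)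
  have a0 : 0 ≤ a y := le_trans (by positivity) a1
  have b0 : 0 ≤ b y := le_trans (by positivity) b1
  have v1 : (mA * (1 - δ / 100) * t y) * (mB * (1 - δ / 100) * T) ≤ a y * sB := mul_le_mul a1 hsb.1 (by positivity) a0
  have v2 : (mB * (1 - δ / 100) * t y) * (mA * (1 - δ / 100) * T) ≤ b y * sA := mul_le_mul b1 hsa.1 (by positivity) b0
  have e3 : 0 ≤ 1 - δ / 10 := by linarith
  have e4 : 0 ≤ 1 + δ / 10 := by linarith
  have w1 := mul_le_mul_of_nonneg_left u1 e3
  have w2 := mul_le_mul_of_nonneg_left v1 e4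
  constructor
  · rw [← mul_div_assoc, div_le_div_iff₀ sa sb]
    nlinarith
  · rw [← mul_div_assoc, div_le_div_iff₀ sb sa]
    nlinarith

theorem main (hd : 3 ≤ d) (W : SRW d Ω)
    (δ : ℝ) (hδ0 : 0 < δ) (hδ1 : δ < 1) :
    ∃ c₃ : ℝ, 2 ≤ c₃ ∧
      ∀ (L K : ℕ), 1 ≤ L → c₃ ≤ (K : ℝ) →
        ∀ A : Set (Zd d), A.Nonempty → A ⊆ ball (0 : Zd d) L →
          ∀ B : Set (Zd d), B.Finite → B ∩ ball (0 : Zd d) (K * L) = A → connSet Bᶜ →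
            ∀ y ∈ A,
              0 < ∑ᶠ z ∈ A, W.eqm B z ∧
              (1 - δ / 10) * W.ebar A y ≤ W.eqm B y / ∑ᶠ z ∈ A, W.eqm B z ∧
              W.eqm B y / ∑ᶠ z ∈ A, W.eqm B z ≤ (1 + δ / 10) * W.ebar A y := by
  obtain ⟨c₀, hc⟩ := compare hd (δ / 100) (by positivity)
  refine ⟨max 2 c₀, le_max_left _ _, ?_⟩
  intro L K hL hK A hne hA B hB hBA hconn y hy
  have hK2 : 2 ≤ K := by exact_mod_cast (le_max_left 2 c₀).trans hK
  obtain ⟨p, p0, hp⟩ := hc L K hL ((le_max_right _ _).trans hK) A hA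
  have hAB : A ⊆ B := by rw [← hBA]; exact inter_subset_left
  have nB : ∀ z ∈ ball (0 : Zd d) (K * L), z ∉ A → z ∉ B := fun z h1 h2 h3 => h2 (by rw [← hBA]; exact ⟨h3, h1⟩)
  obtain ⟨hb, b0, b1, b2, b3, b4⟩ := hfun hd W B
  obtain ⟨ha, a0, a1, a2, a3, a4⟩ := hfun hd W A
  have bpos := h_pos hd B hB hconn hb b0 b2 b4
  obtain ⟨mB, hmB, HB⟩ := hp hb b0 (fun z hz => b1 z (hAB hz)) (fun z h1 h2 => b2 z (nB z h1 h2))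
  obtain ⟨mA, hmA, HA⟩ := hp ha a0 a1 (fun z h1 h2 => a2 z h2)
  have Afin : A.Finite := hB.subset hAB
  have hba : ∀ z, hb z ≤ ha z := fun z => by
    refine le_of_tendsto_of_tendsto' (b4 z) (a4 z) fun n => ?_
    by_cases hA : z ∈ A
    · simp [hA, hAB hA]
    · by_cases hB : z ∈ B
      · simp [hA, hB, kn_nonneg]
      · simp [hA, hB, kn_anti hAB]
  have Av0 : ∀ f : Zd d → ℝ, (∀ z, 0 ≤ f z) → ∀ z, 0 ≤ Av f z := fun f hf z => by
    unfold Av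
    exact div_nonneg (Finset.sum_nonneg fun i _ => add_nonneg (hf _) (hf _)) (by positivity)
  have hd0 : (0:ℝ) < 2 * d := by positivity
  have i0 : Fin d := ⟨0, by omega⟩
  obtain ⟨z, hzA, hz⟩ := Afin.toFinset.exists_max_image (fun z => z i0) (by simpa using hne)
  have zA : z ∈ A := by simpa using hzA
  have z1 : z + ev i0 ∉ A := fun h => by
    have := hz _ (by simpa using h)
    simp [ev] at this
  have z2 : z + ev i0 ∈ ball (0 : Zd d) (K * L) := by
    rw [mem_ball0]
    intro j
    have h1 := mem_ball0.1 (hA zA) j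
    have h2 : ((z + ev i0) j).natAbs ≤ (z j).natAbs + 1 := by
      by_cases hj : j = i0
      · subst hj; simp [ev]; omega
      · simp [ev, hj]
    nlinarith
  have zpos : 0 < Av hb z := by
    have h3 := (Av_ge b0 z i0).1
    have h4 := bpos _ (nB _ z2 z1)
    exact lt_of_lt_of_le (by positivity) h3
  have sb : 0 < ∑ z ∈ Afin.toFinset, Av hb z :=
    Finset.sum_pos' (fun z _ => Av0 hb b0 z) ⟨z, hzA, zpos⟩
  have sa : 0 < ∑ z ∈ Afin.toFinset, Av ha z :=
    lt_of_lt_of_le sb (Finset.sum_le_sum fun z _ => Av_mono fun i => ⟨hba _, hba _⟩)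
  have eB : ∑ᶠ z ∈ A, W.eqm B z = ∑ z ∈ Afin.toFinset, Av hb z := by
    rw [finsum_mem_eq_finite_toFinset_sum _ Afin]
    exact Finset.sum_congr rfl fun z hz => b3 z (hAB (by simpa using hz))
  have eA : W.cap A = ∑ z ∈ Afin.toFinset, Av ha z := by
    rw [SRW.cap, finsum_eq_sum_of_support_subset (s := Afin.toFinset)]
    · exact Finset.sum_congr rfl fun z hz => a3 z (by simpa using hz)
    · intro z hz
      by_contra h
      apply hz
      rw [SRW.eqm, if_neg (by simpa using h)]
  rw [SRW.ebar, eB, eA, b3 y (hAB hy), a3 y hy]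
  refine ⟨sb, ?_⟩
  exact ratio δ hδ0 hδ1 Afin.toFinset (Av ha) (Av hb) (Av p) mA mB hmA hmB (fun z _ => Av0 p p0 z)
    (fun z hz => HA z (by simpa using hz)) (fun z hz => HB z (by simpa using hz)) sa sb y (by simpa using hy)

end S7

/-- Proposition 1.5, (1.26): `e_B(A) > 0` and
`(1 − δ/10)·ē_A(y) ≤ e_B(y)/e_B(A) ≤ (1 + δ/10)·ē_A(y)`. -/
theorem statement7 {d : ℕ} (hd : 3 ≤ d) {Ω : Type*} [MeasurableSpace Ω] (W : SRW d Ω)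
    (δ : ℝ) (hδ0 : 0 < δ) (hδ1 : δ < 1) :
    ∃ c₃ : ℝ, 2 ≤ c₃ ∧
      ∀ (L K : ℕ), 1 ≤ L → c₃ ≤ (K : ℝ) →
        ∀ A : Set (Zd d), A.Nonempty → A ⊆ ball (0 : Zd d) L →
          ∀ B : Set (Zd d), B.Finite → B ∩ ball (0 : Zd d) (K * L) = A → connSet Bᶜ →
            ∀ y ∈ A,
              0 < ∑ᶠ z ∈ A, W.eqm B z ∧
              (1 - δ / 10) * W.ebar A y ≤ W.eqm B y / ∑ᶠ z ∈ A, W.eqm B z ∧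
              W.eqm B y / ∑ᶠ z ∈ A, W.eqm B z ≤ (1 + δ / 10) * W.ebar A y := by
  exact S7.main hd W δ hδ0 hδ1
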